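/- For all integers N ≥ 0 and n ≥ 1, the remainder after an even number of terms satisfies −exp(−(π/2)√(2n/3)) < R_{2N}(n) < c_{2N}/n^N + exp(−(π/2)√(2n/3)). -/

import Mathlib

open Real Finset Filter Topology

noncomputable def c (m : ℕ) : ℝ :=
  ((-1 : ℝ) ^ m / (4 * Real.sqrt 6) ^ m) *
    ∑ k ∈ Finset.range ((m + 1) / 2 + 1),
      ((m + 1).choose k : ℝ) * ((m + 1 - k : ℕ) : ℝ) / ((m + 1 - 2 * k).factorial : ℝ) *
        (π / 6) ^ ((m : ℤ) - 2 * k)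

/-- The number of partitions of `n`, as a real number. -/
noncomputable def p (n : ℕ) : ℝ := (Fintype.card (Nat.Partition n) : ℝ)

/-- The remainder after `N` terms of the asymptotic expansion. -/
noncomputable def R (N n : ℕ) : ℝ :=
  4 * Real.sqrt 3 * (n : ℝ) * Real.exp (-(π * Real.sqrt (2 * n / 3))) * p n -
    ∑ m ∈ Finset.range N, c m / (n : ℝ) ^ ((m : ℝ) / 2)

/-- The number of partitions of `n` into parts of size at most `m`. -/
def boundedPartitions (m n : ℕ) : ℕ := #(Nat.Partition.restricted n (· ≤ m))

open PowerSeries in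
lemma boundedPartitions_series (m : ℕ) :
    (PowerSeries.mk fun n ↦ (boundedPartitions (m + 1) n : ℤ)) * (1 - X ^ (m + 1)) =
      PowerSeries.mk fun n ↦ (boundedPartitions m n : ℤ) := by
  let _ : TopologicalSpace ℤ := ⊥
  have : DiscreteTopology ℤ := ⟨rfl⟩
  open scoped PowerSeries.WithPiTopology in
  have key : ∀ m : ℕ, (PowerSeries.mk fun n ↦ (boundedPartitions m n : ℤ)) =
      ∏ i ∈ Finset.range m, ∑' j : ℕ, (X ^ ((i + 1) * j) : PowerSeries ℤ) := by
    intro m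
    have h := Nat.Partition.powerSeriesMk_card_restricted_eq_tprod ℤ (fun i ↦ i ≤ m)
    simp only [boundedPartitions]
    rw [h, tprod_eq_prod (s := Finset.range m)]
    · refine Finset.prod_congr rfl fun i hi ↦ ?_
      rw [if_pos (by have := Finset.mem_range.1 hi; omega)]
    · intro i hi
      rw [if_neg (by simpa using hi)]
  rw [key, key, Finset.prod_range_succ, mul_assoc]
  convert mul_one _ using 2
  simp_rw [pow_mul]
  open scoped PowerSeries.WithPiTopology in
  exact PowerSeries.WithPiTopology.tsum_pow_mul_one_sub_of_constantCoeff_eq_zero (by simp)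

lemma boundedPartitions_zero (n : ℕ) : boundedPartitions 0 n = if n = 0 then 1 else 0 := by
  unfold boundedPartitions Nat.Partition.restricted
  split_ifs with h
  · subst h; rfl
  · rw [Finset.card_eq_zero, Finset.filter_eq_empty_iff]
    intro q _ hq
    obtain ⟨i, hi⟩ : ∃ i, i ∈ q.parts := by
      apply Multiset.exists_mem_of_ne_zero
      intro h0
      apply h
      rw [← q.parts_sum, h0, Multiset.sum_zero]
    have := hq i hi
    have := q.parts_pos hi
    omega

lemma boundedPartitions_succ (m n : ℕ) : boundedPartitions (m + 1) n = boundedPartitions m n +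
    if m + 1 ≤ n then boundedPartitions (m + 1) (n - (m + 1)) else 0 := by
  have h := congrArg (PowerSeries.coeff n) (boundedPartitions_series m)
  rw [mul_sub, mul_one, map_sub, PowerSeries.coeff_mul_X_pow'] at h
  simp only [PowerSeries.coeff_mk] at h
  split_ifs at h ⊢ <;> zify <;> linarith

lemma boundedPartitions_eq {m n : ℕ} (h : n ≤ m) :
    boundedPartitions m n = Fintype.card (Nat.Partition n) := by
  unfold boundedPartitions Nat.Partition.restricted
  rw [Finset.filter_true_of_mem, Finset.card_univ]
  intro q _ i hi
  have := Multiset.single_le_sum (fun _ _ ↦ Nat.zero_le _) _ hi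
  rw [q.parts_sum] at this
  omega

lemma boundedPartitions_le (m n : ℕ) :
    boundedPartitions m n ≤ Fintype.card (Nat.Partition n) :=
  (Finset.card_le_univ _)

lemma hasSum_boundedPartitions (m : ℕ) {q : ℂ} (hq : ‖q‖ < 1) :
    Summable (fun n ↦ (boundedPartitions m n : ℝ) * ‖q‖ ^ n) ∧
    HasSum (fun n ↦ (boundedPartitions m n : ℂ) * q ^ n)
      (∏ i ∈ Finset.range m, (1 - q ^ (i + 1)))⁻¹ := by
  induction m with
  | zero =>
    simp only [boundedPartitions_zero]
    constructor
    · apply summable_of_ne_finset_zero (s := {0})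
      intro b hb
      simp at hb
      simp [hb]
    · convert hasSum_ite_eq 0 (1 : ℂ) using 2 with n
      · split_ifs with h <;> simp [h]
      · simp
  | succ m ih =>
    obtain ⟨h1, h2⟩ := ih
    set r := ‖q‖ with hr
    have hr0 : 0 ≤ r := norm_nonneg _
    have hrm : r ^ (m + 1) < 1 := pow_lt_one₀ hr0 hq (by omega)
    have hs : Summable (fun n ↦ (boundedPartitions (m + 1) n : ℝ) * r ^ n) := by
      refine summable_of_sum_range_le (c := (∑' n, (boundedPartitions m n : ℝ) * r ^ n) /
        (1 - r ^ (m + 1))) (fun n ↦ by positivity) fun N ↦ ?_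
      rw [le_div_iff₀ (by linarith), mul_sub, mul_one, sub_le_iff_le_add]
      have e1 : ∑ n ∈ range N, (boundedPartitions (m + 1) n : ℝ) * r ^ n =
          ∑ n ∈ range N, (boundedPartitions m n : ℝ) * r ^ n + ∑ n ∈ range N, (if m + 1 ≤ n then
            (boundedPartitions (m + 1) (n - (m + 1)) : ℝ) * r ^ n else 0) := by
        rw [← Finset.sum_add_distrib]
        refine Finset.sum_congr rfl fun n _ ↦ ?_
        rw [boundedPartitions_succ]
        split_ifs <;> push_cast <;> ring
      refine e1.trans_le (add_le_add ?_ ?_)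
      · exact h1.sum_le_tsum _ (fun _ _ ↦ by positivity)
      · rw [← Finset.sum_filter, Finset.sum_mul]
        calc _ ≤ ∑ n ∈ (range N).map (addRightEmbedding (m + 1)),
              (boundedPartitions (m + 1) (n - (m + 1)) : ℝ) * r ^ n := by
              apply Finset.sum_le_sum_of_subset_of_nonneg
              · intro n hn
                simp only [Finset.mem_filter, Finset.mem_range, Finset.mem_map] at hn ⊢
                exact ⟨n - (m + 1), by omega, by simp; omega⟩
              · intros; positivity
          _ ≤ _ := by
              rw [Finset.sum_map]
              refine le_of_eq (Finset.sum_congr rfl fun n _ ↦ ?_)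
              simp [pow_add, mul_assoc]
    refine ⟨hs, ?_⟩
    have hs' : Summable (fun n ↦ (boundedPartitions (m + 1) n : ℂ) * q ^ n) := by
      apply Summable.of_norm
      simpa using hs
    obtain ⟨T, hT⟩ := hs'
    have hq1 : (1 - q ^ (m + 1)) ≠ 0 := by
      intro h
      have : ‖q ^ (m + 1)‖ = 1 := by rw [← sub_eq_zero.1 h]; simp
      rw [norm_pow] at this
      linarith
    have hshift : HasSum (fun n ↦ if m + 1 ≤ n then
        (boundedPartitions (m + 1) (n - (m + 1)) : ℂ) * q ^ n else 0) (T * q ^ (m + 1)) := by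
      have h0 : ∑ i ∈ range (m + 1), (if m + 1 ≤ i then
          (boundedPartitions (m + 1) (i - (m + 1)) : ℂ) * q ^ i else 0) = 0 :=
        Finset.sum_eq_zero fun i hi ↦ if_neg (by simpa using hi)
      rw [← hasSum_nat_add_iff' (m + 1), h0, sub_zero]
      have h5 := hT.mul_right (q ^ (m + 1))
      refine h5.congr_fun fun n ↦ ?_
      rw [if_pos (by omega), Nat.add_sub_cancel, pow_add, mul_assoc]
    have h3 := (h2.add hshift)
    have h4 : T = (∏ i ∈ range m, (1 - q ^ (i + 1)))⁻¹ + T * q ^ (m + 1) := by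
      refine hT.unique ?_
      convert h3 using 2 with n
      rw [boundedPartitions_succ]
      split_ifs <;> push_cast <;> ring
    rw [Finset.prod_range_succ, mul_inv]
    convert hT using 1
    rw [← div_eq_mul_inv, div_eq_iff hq1]
    linear_combination -h4

lemma tendsto_prod_one_sub_pow {q : ℂ} (hq : ‖q‖ < 1) :
    Tendsto (fun m ↦ (∏ i ∈ Finset.range m, (1 - q ^ (i + 1)))⁻¹) atTop
      (𝓝 (∏' i, (1 - q ^ (i + 1)))⁻¹) := by
  refine (ModularForm.multipliable_one_sub_pow hq).hasProd.tendsto_prod_nat.inv₀ ?_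
  have := tprod_one_add_ne_zero_of_summable (f := fun n : ℕ ↦ -q ^ (n + 1)) ?_ ?_
  · simpa [sub_eq_add_neg] using this
  · intro i h
    have : ‖q ^ (i + 1)‖ = 1 := by rw [← sub_eq_zero.1 ((sub_eq_add_neg _ _).trans h)]; simp
    rw [norm_pow] at this
    have := pow_lt_one₀ (norm_nonneg q) hq (show i + 1 ≠ 0 by omega)
    linarith
  · simpa using (summable_nat_add_iff 1).mpr (summable_geometric_of_lt_one (norm_nonneg _) hq)

lemma summable_p {r : ℝ} (hr0 : 0 ≤ r) (hr : r < 1) : Summable fun n ↦ p n * r ^ n := by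
  have hq : ‖(r : ℂ)‖ < 1 := by simpa [abs_of_nonneg hr0]
  obtain ⟨B, hB⟩ := (tendsto_prod_one_sub_pow hq).norm.bddAbove_range
  refine summable_of_sum_range_le (c := B) (fun n ↦ by unfold p; positivity) fun N ↦ ?_
  obtain ⟨h1, h2⟩ := hasSum_boundedPartitions N hq
  have h3 : ∑ n ∈ range N, p n * r ^ n = ∑ n ∈ range N, (boundedPartitions N n : ℝ) * r ^ n := by
    refine Finset.sum_congr rfl fun n hn ↦ ?_
    rw [p, boundedPartitions_eq (by have := Finset.mem_range.1 hn; omega)]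
  simp only [Complex.norm_real, Real.norm_eq_abs, abs_of_nonneg hr0] at h1
  rw [h3]
  refine (h1.sum_le_tsum _ fun _ _ ↦ by positivity).trans (le_trans (le_of_eq ?_)
    (hB (Set.mem_range_self N)))
  have h4 : ((∑' n, (boundedPartitions N n : ℝ) * r ^ n : ℝ) : ℂ) =
      (∏ i ∈ Finset.range N, (1 - (r : ℂ) ^ (i + 1)))⁻¹ := by
    rw [← h2.tsum_eq]
    push_cast
    rfl
  rw [← h4, Complex.norm_real, Real.norm_of_nonneg]
  exact tsum_nonneg fun _ ↦ by positivity

/-- Euler's generating function for partitions. -/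
lemma hasSum_p {q : ℂ} (hq : ‖q‖ < 1) :
    HasSum (fun n ↦ (p n : ℂ) * q ^ n) (∏' i, (1 - q ^ (i + 1)))⁻¹ := by
  have hs := summable_p (norm_nonneg q) hq
  have hs' : Summable (fun n ↦ (p n : ℂ) * q ^ n) := by
    apply Summable.of_norm
    refine hs.congr fun n ↦ ?_
    rw [norm_mul, norm_pow, Complex.norm_real, Real.norm_of_nonneg (by unfold p; positivity)]
  have ht : Tendsto (fun m ↦ ∑' n, (boundedPartitions m n : ℂ) * q ^ n) atTop
      (𝓝 (∑' n, (p n : ℂ) * q ^ n)) := by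
    refine tendsto_tsum_of_dominated_convergence hs (fun n ↦ ?_) (.of_forall fun m n ↦ ?_)
    · refine tendsto_const_nhds.congr' ?_
      filter_upwards [eventually_ge_atTop n] with m hm
      rw [boundedPartitions_eq hm, p]
      simp
    · rw [norm_mul, norm_pow, Complex.norm_natCast, p]
      gcongr
      exact boundedPartitions_le m n
  have he : ∑' n, (p n : ℂ) * q ^ n = (∏' i, (1 - q ^ (i + 1)))⁻¹ := by
    refine tendsto_nhds_unique ht ((tendsto_prod_one_sub_pow hq).congr fun m ↦ ?_)
    exact (hasSum_boundedPartitions m hq).2.tsum_eq.symm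
  exact he ▸ hs'.hasSum

/-- The partition generating function in the variable `s`, with `q = exp (-2 π s)`. -/
noncomputable def partitionGenFun (s : ℂ) : ℂ :=
  (∏' i : ℕ, (1 - Complex.exp (-(2 * π * s)) ^ (i + 1)))⁻¹

lemma norm_exp_neg_two_pi (s : ℂ) : ‖Complex.exp (-(2 * π * s))‖ = Real.exp (-(2 * π * s.re)) := by
  rw [Complex.norm_exp]; simp

lemma norm_exp_neg_two_pi_lt {s : ℂ} (hs : 0 < s.re) : ‖Complex.exp (-(2 * π * s))‖ < 1 := by
  rw [norm_exp_neg_two_pi, Real.exp_lt_one_iff]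
  have := Real.pi_pos
  nlinarith [mul_pos Real.pi_pos hs]

lemma eta_I_mul (s : ℂ) :
    ModularForm.eta (Complex.I * s) = Complex.exp (-(π * s / 12)) * (partitionGenFun s)⁻¹ := by
  rw [ModularForm.eta, partitionGenFun, inv_inv]
  congr 1
  · rw [Function.Periodic.qParam]
    congr 1
    push_cast
    linear_combination (π * s / 12) * Complex.I_mul_I
  · congr 1
    ext i
    rw [ModularForm.eta_q_eq_pow]
    congr 3
    linear_combination (2 * π * s) * Complex.I_mul_I

lemma partitionGenFun_ne_zero {s : ℂ} (hs : 0 < s.re) : partitionGenFun s ≠ 0 := by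
  have h := ModularForm.eta_ne_zero (z := Complex.I * s) (by simpa using hs)
  rw [eta_I_mul] at h
  simpa using right_ne_zero_of_mul h

lemma sqrt_I_mul {s : ℂ} (hs : 0 < s.re) :
    Complex.sqrt (Complex.I * s) = Complex.sqrt Complex.I * Complex.sqrt s := by
  have hs0 : s ≠ 0 := by rintro rfl; simp at hs
  have h1 := abs_lt.1 (Complex.abs_arg_lt_pi_div_two_iff.2 (Or.inl hs))
  rw [_root_.sqrt_eq_exp (mul_ne_zero Complex.I_ne_zero hs0), _root_.sqrt_eq_exp Complex.I_ne_zero,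
    _root_.sqrt_eq_exp hs0, Complex.log_mul Complex.I_ne_zero hs0, ← Complex.exp_add]
  · congr 1; ring
  · rw [Complex.arg_I]
    constructor <;> linarith

lemma partitionGenFun_inv {s : ℂ} (hs : 0 < s.re) :
    partitionGenFun s = Complex.sqrt s * Complex.exp (π / 12 * (s⁻¹ - s)) *
      partitionGenFun s⁻¹ := by
  have hs0 : s ≠ 0 := by rintro rfl; simp at hs
  have hs1 : 0 < (s⁻¹).re := by
    rw [Complex.inv_re]
    exact div_pos hs (Complex.normSq_pos.2 hs0)
  have h := ModularForm.eta_comp_eq_csqrt_I_inv (x := Complex.I * s) (by simpa using hs)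
  have h2 : -1 / (Complex.I * s) = Complex.I * s⁻¹ := by
    field_simp; simp
  have hI : Complex.sqrt Complex.I ≠ 0 := by simp [Complex.sqrt]
  simp only [Function.comp_apply, h2, Pi.smul_apply, Pi.mul_apply, smul_eq_mul, eta_I_mul,
    sqrt_I_mul hs] at h
  have n1 := partitionGenFun_ne_zero hs
  have n2 := partitionGenFun_ne_zero hs1
  rw [mul_sub, Complex.exp_sub]
  have e1 : Complex.exp (-(π * s / 12)) = (Complex.exp (π / 12 * s))⁻¹ := by
    rw [← Complex.exp_neg]; congr 1; ring
  have e2 : Complex.exp (-(π * s⁻¹ / 12)) = (Complex.exp (π / 12 * s⁻¹))⁻¹ := by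
    rw [← Complex.exp_neg]; congr 1; ring
  rw [e1, e2] at h
  have m1 := Complex.exp_ne_zero (π / 12 * s)
  have m2 := Complex.exp_ne_zero (π / 12 * s⁻¹)
  generalize partitionGenFun s⁻¹ = P at *
  generalize Complex.exp (π / 12 * s⁻¹) = E at *
  generalize Complex.exp (π / 12 * s) = F at *
  field_simp at h ⊢
  linear_combination h

/-- Euler-type product identity relating `q`, `-q`, `q^2` and `q^4`. -/
lemma prod_neg_pow_identity (q : ℂ) (N : ℕ) :
    (∏ n ∈ range (2 * N), (1 - (-q) ^ (n + 1))) * (∏ n ∈ range (2 * N), (1 - q ^ (n + 1))) *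
      (∏ n ∈ range N, (1 - (q ^ 4) ^ (n + 1))) =
    (∏ n ∈ range (2 * N), (1 - (q ^ 2) ^ (n + 1))) *
      (∏ n ∈ range N, (1 - (q ^ 2) ^ (n + 1))) ^ 2 := by
  induction N with
  | zero => simp
  | succ N ih =>
    rw [show 2 * (N + 1) = 2 * N + 1 + 1 by ring]
    simp only [prod_range_succ]
    have e1 : (-q) ^ (2 * N + 1) = - q ^ (2 * N + 1) := Odd.neg_pow ⟨N, rfl⟩ q
    have e2 : (-q) ^ (2 * N + 1 + 1) = q ^ (2 * N + 1 + 1) := Even.neg_pow ⟨N + 1, by ring⟩ q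
    rw [e1, e2]
    linear_combination
      ((1 + q ^ (2 * N + 1)) * (1 - q ^ (2 * N + 1 + 1)) * (1 - q ^ (2 * N + 1)) *
       (1 - q ^ (2 * N + 1 + 1)) * (1 - (q ^ 4) ^ (N + 1))) * ih

lemma partitionGenFun_add_half {s : ℂ} (hs : 0 < s.re) :
    partitionGenFun (s + Complex.I / 2) =
      partitionGenFun (2 * s) ^ 3 / (partitionGenFun s * partitionGenFun (4 * s)) := by
  set q := Complex.exp (-(2 * π * s)) with hq
  have hq1 : ‖q‖ < 1 := norm_exp_neg_two_pi_lt hs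
  have hm : Complex.exp (-(2 * π * (s + Complex.I / 2))) = - q := by
    rw [show -(2 * π * (s + Complex.I / 2)) = -(2 * π * s) - π * Complex.I by ring,
      Complex.exp_sub, Complex.exp_pi_mul_I, div_neg, div_one]
  have h2 : Complex.exp (-(2 * π * (2 * s))) = q ^ 2 := by
    rw [hq, ← Complex.exp_nat_mul]; congr 1; push_cast; ring
  have h4 : Complex.exp (-(2 * π * (4 * s))) = q ^ 4 := by
    rw [hq, ← Complex.exp_nat_mul]; congr 1; push_cast; ring
  have key : ∀ r : ℂ, ‖r‖ < 1 → Tendsto (fun N ↦ ∏ n ∈ range N, (1 - r ^ (n + 1))) atTop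
      (𝓝 (∏' n : ℕ, (1 - r ^ (n + 1)))) := fun r hr ↦
    (ModularForm.multipliable_one_sub_pow hr).hasProd.tendsto_prod_nat
  have h2N : Tendsto (fun N : ℕ ↦ 2 * N) atTop atTop :=
    tendsto_id.const_mul_atTop' (by norm_num)
  have hq2 : ‖q ^ 2‖ < 1 := by rw [norm_pow]; exact pow_lt_one₀ (norm_nonneg _) hq1 (by norm_num)
  have hq4 : ‖q ^ 4‖ < 1 := by rw [norm_pow]; exact pow_lt_one₀ (norm_nonneg _) hq1 (by norm_num)
  have t1 := (((key (-q) (by simpa using hq1)).comp h2N).mul ((key q hq1).comp h2N)).mul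
    (key (q ^ 4) hq4)
  have t2 := ((key (q ^ 2) hq2).comp h2N).mul ((key (q ^ 2) hq2).pow 2)
  have := tendsto_nhds_unique t1 (t2.congr fun N ↦ (prod_neg_pow_identity q N).symm)
  have n1 := partitionGenFun_ne_zero hs
  have n2 := partitionGenFun_ne_zero (s := 2 * s) (by simpa using hs)
  have n4 := partitionGenFun_ne_zero (s := 4 * s) (by simpa using hs)
  have nm := partitionGenFun_ne_zero (s := s + Complex.I / 2) (by simpa using hs)
  rw [partitionGenFun] at n1 n2 n4 nm
  rw [partitionGenFun, partitionGenFun, partitionGenFun, partitionGenFun]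
  rw [h2] at n2 ⊢
  rw [h4] at n4 ⊢
  rw [hm] at nm ⊢
  rw [← hq] at n1 ⊢
  simp only [ne_eq, inv_eq_zero] at n1 n2 n4 nm
  field_simp
  linear_combination -this

lemma hasSum_partitionGenFun {s : ℂ} (hs : 0 < s.re) :
    HasSum (fun n ↦ (p n : ℂ) * Complex.exp (-(2 * π * s)) ^ n) (partitionGenFun s) :=
  hasSum_p (norm_exp_neg_two_pi_lt hs)

lemma norm_complex_sqrt (z : ℂ) : ‖Complex.sqrt z‖ = Real.sqrt ‖z‖ := by
  have := Complex.norm_cpow_inv_nat z 2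
  rw [Real.sqrt_eq_rpow, Complex.sqrt]
  simpa using this

lemma complex_sqrt_sq (z : ℂ) : Complex.sqrt z ^ 2 = z := by
  rw [Complex.sqrt]
  exact Complex.cpow_ofNat_inv_pow z 2

lemma sqrt_ofReal_mul {a : ℝ} (ha : 0 < a) {s : ℂ} (hs : s ≠ 0) :
    Complex.sqrt (a * s) = Real.sqrt a * Complex.sqrt s := by
  have ha' : (a : ℂ) ≠ 0 := by exact_mod_cast ha.ne'
  rw [_root_.sqrt_eq_exp (mul_ne_zero ha' hs), _root_.sqrt_eq_exp hs, Complex.log_ofReal_mul ha hs,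
    Real.sqrt_eq_rpow, Real.rpow_def_of_pos ha, Complex.ofReal_exp, ← Complex.exp_add]
  congr 1
  push_cast
  ring

lemma inv_re_pos {s : ℂ} (hs : 0 < s.re) : 0 < (s⁻¹).re := by
  have hs0 : s ≠ 0 := by rintro rfl; simp at hs
  rw [Complex.inv_re]
  exact div_pos hs (Complex.normSq_pos.2 hs0)

lemma partitionGenFun_add_half_inv {s : ℂ} (hs : 0 < s.re) :
    partitionGenFun (s + Complex.I / 2) =
      Real.sqrt 2 * Complex.sqrt s * Complex.exp (π / 12 * ((4 * s)⁻¹ - s)) *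
        partitionGenFun ((4 * s)⁻¹ + Complex.I / 2) := by
  have hs0 : s ≠ 0 := by rintro rfl; simp at hs
  have h4 : 0 < (4 * s).re := by simpa using hs
  have h2 : 0 < (2 * s).re := by simpa using hs
  have hi := inv_re_pos h4
  have e2 : (2 * s)⁻¹ = 2 * (4 * s)⁻¹ := by field_simp; norm_num
  have e1 : s⁻¹ = 4 * (4 * s)⁻¹ := by field_simp
  rw [partitionGenFun_add_half hs, partitionGenFun_add_half hi, partitionGenFun_inv hs,
    partitionGenFun_inv h2, partitionGenFun_inv h4, e2, e1]
  have n1 := partitionGenFun_ne_zero hi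
  have n2 := partitionGenFun_ne_zero (s := 2 * (4 * s)⁻¹) (by rw [← e2]; exact inv_re_pos h2)
  have n4 := partitionGenFun_ne_zero (s := 4 * (4 * s)⁻¹) (by rw [← e1]; exact inv_re_pos hs)
  have q2 : Complex.sqrt (2 * s) = Real.sqrt 2 * Complex.sqrt s := by
    exact_mod_cast sqrt_ofReal_mul (a := 2) (by norm_num) hs0
  have q4 : Complex.sqrt (4 * s) = 2 * Complex.sqrt s := by
    have := sqrt_ofReal_mul (a := 4) (by norm_num) hs0
    rw [show (4 : ℝ) = 2 ^ 2 by norm_num, Real.sqrt_sq (by norm_num)] at this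
    push_cast at this
    rw [← this]; norm_num
  have hq : Complex.sqrt s ≠ 0 := by
    intro h; apply hs0; rw [← complex_sqrt_sq s, h]; simp
  have hr : (Real.sqrt 2 : ℂ) ^ 2 = 2 := by
    rw [← Complex.ofReal_pow, Real.sq_sqrt (by norm_num)]; norm_num
  rw [q2, q4]
  generalize (4 * s)⁻¹ = w at *
  have ex : Complex.exp (π / 12 * (2 * w - 2 * s)) ^ 3 = Complex.exp (π / 12 * (w - s)) *
      (Complex.exp (π / 12 * (4 * w - s)) * Complex.exp (π / 12 * (w - 4 * s))) := by
    rw [← Complex.exp_nat_mul, ← Complex.exp_add, ← Complex.exp_add]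
    congr 1; push_cast; ring
  have m1 := Complex.exp_ne_zero (π / 12 * (4 * w - s))
  have m2 := Complex.exp_ne_zero (π / 12 * (w - 4 * s))
  rw [mul_pow, mul_pow, ex]
  generalize Complex.exp (π / 12 * (4 * w - s)) = E1 at *
  generalize Complex.exp (π / 12 * (w - 4 * s)) = E2 at *
  field_simp
  rw [hr]

lemma p_le_two_pow (n : ℕ) : p n ≤ 2 ^ (n - 1) := by
  have h := Fintype.card_le_of_surjective _ (Nat.Partition.ofComposition_surj (n := n))
  rw [composition_card] at h
  unfold p
  exact_mod_cast h

lemma p_zero : p 0 = 1 := by simp [p]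

lemma p_nonneg (n : ℕ) : 0 ≤ p n := by unfold p; positivity

lemma norm_partitionGenFun_sub_one_le {s : ℂ} {r : ℝ} (hs : 0 < s.re)
    (hr : Real.exp (-(2 * π * s.re)) = r) (hr2 : r < 1 / 2) :
    ‖partitionGenFun s - 1‖ ≤ r / (1 - 2 * r) := by
  have hr0 : 0 < r := hr ▸ Real.exp_pos _
  have h := hasSum_partitionGenFun hs
  have h1 := (hasSum_nat_add_iff' 1).2 h
  simp only [sum_range_one, pow_zero, p_zero, Complex.ofReal_one, mul_one] at h1
  rw [← h1.tsum_eq]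
  have hg : HasSum (fun n : ℕ ↦ r * (2 * r) ^ n) (r * (1 - 2 * r)⁻¹) :=
    (hasSum_geometric_of_lt_one (by linarith) (by linarith)).mul_left r
  rw [div_eq_mul_inv]
  refine tsum_of_norm_bounded hg fun n ↦ ?_
  rw [norm_mul, norm_pow, norm_exp_neg_two_pi, hr, Complex.norm_real,
    Real.norm_of_nonneg (p_nonneg _)]
  have := p_le_two_pow (n + 1)
  rw [Nat.add_sub_cancel] at this
  calc p (n + 1) * r ^ (n + 1) ≤ 2 ^ n * r ^ (n + 1) := by gcongr
    _ = _ := by rw [mul_pow]; ring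

open scoped ModularForm in
lemma norm_partitionGenFun_pow (z : UpperHalfPlane) (g : Matrix.SpecialLinearGroup (Fin 2) ℤ) :
    ‖partitionGenFun (-Complex.I * z)‖ ^ 24 =
      (z.im / (g • z).im) ^ 6 * Real.exp (2 * π * ((g • z).im - z.im)) *
        ‖partitionGenFun (-Complex.I * (g • z : UpperHalfPlane))‖ ^ 24 := by
  have hD : ∀ w : UpperHalfPlane, ‖ModularForm.discriminant w‖ =
      Real.exp (-(2 * π * w.im)) / ‖partitionGenFun (-Complex.I * w)‖ ^ 24 := by
    intro w
    have := eta_I_mul (-Complex.I * w)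
    rw [show Complex.I * (-Complex.I * (w : ℂ)) = w by
      linear_combination (-w : ℂ) * Complex.I_mul_I] at this
    rw [ModularForm.discriminant, this, norm_pow, norm_mul, mul_pow, Complex.norm_exp, norm_inv,
      inv_pow, ← Real.exp_nat_mul, div_eq_mul_inv]
    congr 2
    simp
    ring
  have hinv : ModularForm.discriminant ∣[(12 : ℤ)] g = ModularForm.discriminant :=
    SlashInvariantForm.slash_action_generators_SL2Z ModularForm.discriminant_S_invariant
      ModularForm.discriminant_T_invariant g
  have h := congrFun hinv z
  rw [ModularForm.SL_slash_apply] at h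
  have h' := congrArg norm h
  rw [norm_mul, norm_zpow, hD, hD] at h'
  have him : (g • z).im = z.im / Complex.normSq (UpperHalfPlane.denom g z) :=
    ModularGroup.im_smul_eq_div_normSq g z
  have hd : ‖UpperHalfPlane.denom g z‖ ≠ 0 := by
    simp
  have hq : z.im / (g • z).im = ‖UpperHalfPlane.denom g z‖ ^ 2 := by
    rw [him, Complex.normSq_eq_norm_sq]
    have := z.im_pos.ne'
    field_simp
  rw [hq]
  have pos : ∀ w : UpperHalfPlane, ‖partitionGenFun (-Complex.I * w)‖ ^ 24 ≠ 0 := fun w ↦ by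
    have := partitionGenFun_ne_zero (s := -Complex.I * w) (by simpa using w.im_pos)
    positivity
  have p1 := pos z
  have p2 := pos (g • z)
  rw [mul_sub, Real.exp_sub]
  simp only [Real.exp_neg] at h'
  have := Real.exp_pos (2 * π * z.im)
  have := Real.exp_pos (2 * π * (g • z).im)
  rw [zpow_neg, show (12 : ℤ) = ((12 : ℕ) : ℤ) by norm_num, zpow_natCast] at h'
  generalize ‖partitionGenFun (-Complex.I * z)‖ ^ 24 = P at *
  generalize ‖partitionGenFun (-Complex.I * (g • z : UpperHalfPlane))‖ ^ 24 = Q at *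
  field_simp at h' ⊢
  linear_combination h'

lemma exp_neg_two_pi_mul_le {t : ℝ} (ht : 17 / 20 ≤ t) : Real.exp (-(2 * π * t)) ≤ 1 / 120 := by
  have h5 : (5 : ℝ) ≤ 2 * π * t := by nlinarith [Real.pi_gt_three]
  have e1 : (2.7 : ℝ) ≤ Real.exp 1 := by linarith [Real.exp_one_gt_d9]
  have : (120 : ℝ) ≤ Real.exp (2 * π * t) := by
    calc (120 : ℝ) ≤ 2.7 ^ 5 := by norm_num
      _ ≤ Real.exp 1 ^ 5 := by gcongr
      _ = Real.exp 5 := by rw [← Real.exp_nat_mul]; norm_num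
      _ ≤ _ := Real.exp_le_exp.2 h5
  rw [Real.exp_neg, one_div]
  exact inv_anti₀ (by norm_num) this

/-- The points of the standard fundamental domain satisfy the hypothesis, so that this bounds
the generating function there. -/
lemma norm_partitionGenFun_le_of_re {s : ℂ} (hs : Real.sqrt 3 / 2 ≤ s.re) :
    ‖partitionGenFun s‖ ≤ 101 / 100 := by
  have h3 : (17 / 10 : ℝ) ≤ Real.sqrt 3 := Real.le_sqrt_of_sq_le (by norm_num)
  have hs0 : 0 < s.re := by linarith
  have hr := exp_neg_two_pi_mul_le (t := s.re) (by linarith)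
  have h := norm_partitionGenFun_sub_one_le hs0 rfl (by linarith)
  have h2 : Real.exp (-(2 * π * s.re)) / (1 - 2 * Real.exp (-(2 * π * s.re))) ≤ 1 / 100 := by
    rw [div_le_iff₀ (by linarith)]; linarith
  calc ‖partitionGenFun s‖ = ‖(partitionGenFun s - 1) + 1‖ := by simp
    _ ≤ ‖partitionGenFun s - 1‖ + ‖(1 : ℂ)‖ := norm_add_le _ _
    _ ≤ _ := by rw [norm_one]; linarith

lemma exp_mul_norm_partitionGenFun_sub_one_le {s : ℂ} (hs : 1 ≤ s.re) :
    Real.exp (π / 12 * s.re) * ‖partitionGenFun s - 1‖ ≤ 1 / 10 := by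
  have hs0 : 0 < s.re := by linarith
  have hr := exp_neg_two_pi_mul_le (t := s.re) (by linarith)
  have h := norm_partitionGenFun_sub_one_le hs0 rfl (by linarith)
  have h2 : Real.exp (-(2 * π * s.re)) / (1 - 2 * Real.exp (-(2 * π * s.re))) ≤
      2 * Real.exp (-(2 * π * s.re)) := by
    rw [div_le_iff₀ (by linarith)]
    nlinarith [Real.exp_pos (-(2 * π * s.re))]
  have h4 : Real.exp (-4) ≤ 1 / 20 := by
    have e1 : (2.7 : ℝ) ≤ Real.exp 1 := by linarith [Real.exp_one_gt_d9]
    have : (20 : ℝ) ≤ Real.exp 4 := by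
      calc (20 : ℝ) ≤ 2.7 ^ 4 := by norm_num
        _ ≤ Real.exp 1 ^ 4 := by gcongr
        _ = Real.exp 4 := by rw [← Real.exp_nat_mul]; norm_num
    rw [Real.exp_neg, one_div]
    exact inv_anti₀ (by norm_num) this
  calc Real.exp (π / 12 * s.re) * ‖partitionGenFun s - 1‖
      ≤ Real.exp (π / 12 * s.re) * (2 * Real.exp (-(2 * π * s.re))) := by
        gcongr; exact h.trans h2
    _ = 2 * Real.exp (π / 12 * s.re + -(2 * π * s.re)) := by rw [Real.exp_add]; ring
    _ ≤ 2 * Real.exp (-4) := by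
        gcongr; nlinarith [Real.pi_gt_three]
    _ ≤ _ := by linarith

lemma im_smul_bound {x y : ℝ} (hy : 0 < y) (hy1 : y ≤ 1 / 100) (hx : 0 ≤ x) (hx1 : x ≤ 1 / 2)
    (hY : y / (x ^ 2 + y ^ 2) ≤ 1) (hY2 : y / (4 * ((x - 1 / 2) ^ 2 + y ^ 2)) ≤ 1)
    (a b : ℤ) (hab : IsCoprime a b) (hV : Real.sqrt 3 / 2 ≤ y / ((b - a * x) ^ 2 + (a * y) ^ 2)) :
    y / ((b - a * x) ^ 2 + (a * y) ^ 2) ≤ 1 / (9 * y) := by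
  have h3 : (17 / 10 : ℝ) ≤ Real.sqrt 3 := Real.le_sqrt_of_sq_le (by norm_num)
  have hle1 : (1 : ℝ) ≤ 1 / (9 * y) := by rw [le_div_iff₀ (by positivity)]; linarith
  wlog ha : 0 ≤ a generalizing a b
  · have := this (-a) (-b) hab.neg_neg
    push_cast at this
    have e : ((-b - -a * x) ^ 2 + (-a * y) ^ 2 : ℝ) = (b - a * x) ^ 2 + (a * y) ^ 2 := by ring
    rw [e] at this
    exact this hV (by omega)
  rcases lt_or_ge a 3 with ha3 | ha3
  · interval_cases a
    · exfalso
      have hb : (1 : ℝ) ≤ (b : ℝ) ^ 2 := by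
        have hb0 : b ≠ 0 := by
          rintro rfl; simp [isCoprime_zero_left] at hab
        have : 1 ≤ b ^ 2 := by
          have := sq_pos_of_ne_zero hb0
          omega
        exact_mod_cast this
      have : y / ((b - (0 : ℤ) * x) ^ 2 + ((0 : ℤ) * y) ^ 2) ≤ y := by
        rw [div_le_iff₀ (by push_cast; nlinarith)]
        push_cast
        nlinarith
      linarith
    · refine le_trans ?_ hle1
      refine le_trans ?_ hY
      push_cast
      have hb : x ^ 2 ≤ (b - 1 * x) ^ 2 := by
        rcases le_or_gt b 0 with hb | hb
        · have : (b : ℝ) ≤ 0 := by exact_mod_cast hb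
          nlinarith
        · have : (1 : ℝ) ≤ b := by exact_mod_cast hb
          nlinarith
      rw [one_mul y]
      gcongr
    · refine le_trans ?_ hle1
      refine le_trans ?_ hY2
      push_cast
      have hb : 4 * (x - 1 / 2) ^ 2 ≤ (b - 2 * x) ^ 2 := by
        rcases le_or_gt b 0 with hb | hb
        · have hb' : b ≠ 0 := by
            rintro rfl
            rw [isCoprime_zero_right, Int.isUnit_iff] at hab
            omega
          have : (b : ℝ) ≤ -1 := by exact_mod_cast (by omega : b ≤ -1)
          nlinarith
        · have : (1 : ℝ) ≤ b := by exact_mod_cast hb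
          nlinarith
      have : 4 * ((x - 1 / 2) ^ 2 + y ^ 2) ≤ (b - 2 * x) ^ 2 + (2 * y) ^ 2 := by nlinarith
      gcongr
  · have ha' : (3 : ℝ) ≤ a := by exact_mod_cast ha3
    have : 9 * y ^ 2 ≤ (b - a * x) ^ 2 + (a * y) ^ 2 := by
      have : 9 * y ^ 2 ≤ (a * y) ^ 2 := by
        rw [mul_pow]; gcongr; nlinarith
      nlinarith [sq_nonneg (b - a * x)]
    calc _ ≤ y / (9 * y ^ 2) := by gcongr
      _ = _ := by field_simp

lemma norm_partitionGenFun_le_minor {x y : ℝ} (hy : 0 < y) (hy1 : y ≤ 1 / 100) (hx : 0 ≤ x)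
    (hx1 : x ≤ 1 / 2)
    (hY : y / (x ^ 2 + y ^ 2) ≤ 1) (hY2 : y / (4 * ((x - 1 / 2) ^ 2 + y ^ 2)) ≤ 1) :
    ‖partitionGenFun (y + x * Complex.I)‖ ≤ 101 / 100 * Real.exp (π / (108 * y)) := by
  let z : UpperHalfPlane := ⟨-x + y * Complex.I, by simpa using hy⟩
  have hz : (z : ℂ) = -x + y * Complex.I := rfl
  have hzim : z.im = y := by
    change (-x + y * Complex.I : ℂ).im = y
    simp
  obtain ⟨g, hg⟩ := ModularGroup.exists_smul_mem_fd z
  have h34 := ModularGroup.three_le_four_mul_im_sq_of_mem_fd hg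
  have hVpos := (g • z).im_pos
  have hs3 : Real.sqrt 3 / 2 ≤ (g • z).im := by
    have : Real.sqrt 3 ≤ 2 * (g • z).im := Real.sqrt_le_iff.2 ⟨by positivity, by nlinarith⟩
    linarith
  have him : (g • z).im = y / ((g 1 1 - g 1 0 * x) ^ 2 + (g 1 0 * y) ^ 2) := by
    rw [ModularGroup.im_smul_eq_div_normSq, hzim, ModularGroup.denom_apply, hz,
      Complex.normSq_apply]
    simp
    ring_nf
  have hV : (g • z).im ≤ 1 / (9 * y) := by
    rw [him]
    exact im_smul_bound hy hy1 hx hx1 hY hY2 _ _ (ModularGroup.bottom_row_coprime g) (him ▸ hs3)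
  have h3 : (17 / 10 : ℝ) ≤ Real.sqrt 3 := Real.le_sqrt_of_sq_le (by norm_num)
  have h := norm_partitionGenFun_pow z g
  rw [hzim, show -Complex.I * (z : ℂ) = y + x * Complex.I by
    rw [hz]; linear_combination -y * Complex.I_mul_I] at h
  have hB := norm_partitionGenFun_le_of_re (s := -Complex.I * (g • z : UpperHalfPlane))
    (by simpa using hs3)
  refine le_of_pow_le_pow_left₀ (n := 24) (by norm_num) (by positivity) ?_
  rw [h, mul_pow, ← Real.exp_nat_mul, mul_comm (_ ^ 24) (Real.exp _)]
  refine mul_le_mul ?_ (pow_le_pow_left₀ (norm_nonneg _) hB _) (by positivity) (by positivity)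
  calc (y / (g • z).im) ^ 6 * Real.exp (2 * π * ((g • z).im - y))
      ≤ 1 * Real.exp (2 * π * ((g • z).im - y)) := by
        gcongr
        exact pow_le_one₀ (by positivity) (by rw [div_le_one hVpos]; linarith)
    _ ≤ _ := by
        rw [one_mul]
        apply Real.exp_le_exp.2
        push_cast
        have : 24 * (π / (108 * y)) = 2 * π * (1 / (9 * y)) := by field_simp; norm_num
        rw [this]
        gcongr
        linarith

/-- The contribution of the cusp `0` to the generating function. -/
noncomputable def cuspZeroTerm (s : ℂ) : ℂ := Complex.sqrt s * Complex.exp (π / 12 * (s⁻¹ - s))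

/-- The contribution of the cusp `1/2`, in the variable centred at this cusp. -/
noncomputable def cuspHalfTerm (s : ℂ) : ℂ :=
  Real.sqrt 2 * Complex.sqrt s * Complex.exp (π / 12 * ((4 * s)⁻¹ - s))

lemma norm_cuspZeroTerm_le {s : ℂ} (hs : 0 < s.re) (h1 : ‖s‖ ≤ 1) :
    ‖cuspZeroTerm s‖ ≤ Real.exp (π / 12 * (s⁻¹).re) := by
  rw [cuspZeroTerm, norm_mul, norm_complex_sqrt, Complex.norm_exp]
  have hs1 : Real.sqrt ‖s‖ ≤ 1 := by simpa using Real.sqrt_le_sqrt h1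
  have e : (π / 12 * (s⁻¹ - s) : ℂ).re = π / 12 * ((s⁻¹).re - s.re) := by
    rw [show (π / 12 : ℂ) = ((π / 12 : ℝ) : ℂ) by push_cast; rfl, Complex.re_ofReal_mul,
      Complex.sub_re]
  rw [e]
  calc _ ≤ 1 * Real.exp (π / 12 * (s⁻¹).re) := by
        gcongr; linarith
    _ = _ := one_mul _

lemma norm_cuspHalfTerm_le {s : ℂ} (hs : 0 < s.re) (h1 : ‖s‖ ≤ 1) :
    ‖cuspHalfTerm s‖ ≤ 3 / 2 * Real.exp (π / 12 * ((4 * s)⁻¹).re) := by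
  rw [cuspHalfTerm, norm_mul, norm_mul, norm_complex_sqrt, Complex.norm_exp, Complex.norm_real,
    Real.norm_of_nonneg (Real.sqrt_nonneg _)]
  have hs1 : Real.sqrt ‖s‖ ≤ 1 := by simpa using Real.sqrt_le_sqrt h1
  have h2 : Real.sqrt 2 ≤ 3 / 2 := Real.sqrt_le_iff.2 (by norm_num)
  have e : (π / 12 * ((4 * s)⁻¹ - s) : ℂ).re = π / 12 * (((4 * s)⁻¹).re - s.re) := by
    rw [show (π / 12 : ℂ) = ((π / 12 : ℝ) : ℂ) by push_cast; rfl, Complex.re_ofReal_mul,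
      Complex.sub_re]
  rw [e]
  calc _ ≤ 3 / 2 * 1 * Real.exp (π / 12 * ((4 * s)⁻¹).re) := by
        gcongr; linarith
    _ = _ := by ring

lemma exp_pi_div_twelve_le {a : ℝ} (ha : a ≤ 1) : Real.exp (π / 12 * a) ≤ 7 / 5 := by
  have h1 : π / 12 * a ≤ 7 / 25 := by nlinarith [Real.pi_pos, Real.pi_lt_d2]
  have := Real.exp_bound_div_one_sub_of_interval' (x := 7 / 25) (by norm_num) (by norm_num)
  exact (Real.exp_le_exp.2 h1).trans (this.le.trans (by norm_num))

lemma norm_partitionGenFun_sub_cuspTerms_le {x y : ℝ} (hy : 0 < y) (hy1 : y ≤ 1 / 100) (hx : 0 ≤ x)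
    (hx1 : x ≤ 1 / 2) :
    ‖partitionGenFun (y + x * Complex.I) - cuspZeroTerm (y + x * Complex.I) -
      cuspHalfTerm (y + (x - 1 / 2) * Complex.I)‖ ≤
        4 + 101 / 100 * Real.exp (π / (108 * y)) := by
  set s : ℂ := y + x * Complex.I with hs
  set σ : ℂ := y + (x - 1 / 2) * Complex.I with hσ
  have hsre : s.re = y := by simp [hs]
  have hsim : s.im = x := by simp [hs]
  have hσre : σ.re = y := by simp [hσ]
  have hσim : σ.im = x - 1 / 2 := by simp [hσ]
  have hs0 : 0 < s.re := hsre ▸ hy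
  have hσ0 : 0 < σ.re := hσre ▸ hy
  have hsσ : s = σ + Complex.I / 2 := by rw [hs, hσ]; ring
  have hsn : ‖s‖ ≤ 1 := by
    refine (Complex.norm_le_abs_re_add_abs_im s).trans ?_
    rw [hsre, hsim, abs_of_pos hy, abs_of_nonneg hx]
    linarith
  have hσn : ‖σ‖ ≤ 1 := by
    refine (Complex.norm_le_abs_re_add_abs_im σ).trans ?_
    rw [hσre, hσim, abs_of_pos hy, abs_of_nonpos (by linarith)]
    linarith
  have hY : (s⁻¹).re = y / (x ^ 2 + y ^ 2) := by
    rw [Complex.inv_re, Complex.normSq_apply, hsre, hsim]; ring_nf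
  have hY2 : ((4 * σ)⁻¹).re = y / (4 * ((x - 1 / 2) ^ 2 + y ^ 2)) := by
    rw [Complex.inv_re, Complex.normSq_apply]
    simp [hσre, hσim]
    field_simp
    ring
  have b1 := norm_cuspZeroTerm_le hs0 hsn
  have b2 := norm_cuspHalfTerm_le hσ0 hσn
  have hE := Real.exp_pos (π / (108 * y))
  have tri : ∀ a b c : ℂ, ‖a - b - c‖ ≤ ‖a - b‖ + ‖c‖ := fun a b c ↦ norm_sub_le _ _
  rcases le_or_gt 1 (s⁻¹).re with hA | hA
  · have hx2 : x ^ 2 ≤ 1 / 100 := by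
      rw [hY, le_div_iff₀ (by positivity)] at hA
      nlinarith
    have hx3 : x ≤ 1 / 10 := by nlinarith
    have hY2' : ((4 * σ)⁻¹).re ≤ 1 := by
      rw [hY2, div_le_one (by positivity)]
      nlinarith
    have e1 : ‖partitionGenFun s - cuspZeroTerm s‖ ≤ 1 / 10 := by
      have : partitionGenFun s - cuspZeroTerm s = cuspZeroTerm s * (partitionGenFun s⁻¹ - 1) := by
        rw [partitionGenFun_inv hs0, cuspZeroTerm]; ring
      rw [this, norm_mul]
      refine le_trans ?_ (exp_mul_norm_partitionGenFun_sub_one_le hA)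
      gcongr
    have := exp_pi_div_twelve_le hY2'
    have := tri (partitionGenFun s) (cuspZeroTerm s) (cuspHalfTerm σ)
    linarith
  rcases le_or_gt 1 ((4 * σ)⁻¹).re with hB | hB
  · have e1 : ‖partitionGenFun s - cuspHalfTerm σ‖ ≤ 3 / 20 := by
      have : partitionGenFun s - cuspHalfTerm σ =
          cuspHalfTerm σ * (partitionGenFun ((4 * σ)⁻¹ + Complex.I / 2) - 1) := by
        rw [hsσ, partitionGenFun_add_half_inv hσ0, cuspHalfTerm]; ring
      rw [this, norm_mul]
      have hre : ((4 * σ)⁻¹ + Complex.I / 2).re = ((4 * σ)⁻¹).re := by simp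
      have h := exp_mul_norm_partitionGenFun_sub_one_le (s := (4 * σ)⁻¹ + Complex.I / 2)
        (by rw [hre]; exact hB)
      rw [hre] at h
      calc _ ≤ 3 / 2 * Real.exp (π / 12 * ((4 * σ)⁻¹).re) *
            ‖partitionGenFun ((4 * σ)⁻¹ + Complex.I / 2) - 1‖ := by gcongr
        _ ≤ _ := by rw [mul_assoc]; linarith
    have := exp_pi_div_twelve_le hA.le
    have := tri (partitionGenFun s) (cuspHalfTerm σ) (cuspZeroTerm s)
    rw [sub_right_comm]
    linarith
  · have h := norm_partitionGenFun_le_minor hy hy1 hx hx1 (hY ▸ hA.le) (hY2 ▸ hB.le)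
    rw [← hs] at h
    have := exp_pi_div_twelve_le hA.le
    have := exp_pi_div_twelve_le hB.le
    have := tri (partitionGenFun s) (cuspZeroTerm s) (cuspHalfTerm σ)
    have := norm_sub_le (partitionGenFun s) (cuspZeroTerm s)
    linarith

lemma gaussian_tail {b : ℝ} (hb : 0 ≤ b) :
    |(∫ r in (0:ℝ)..b, Real.exp (-r ^ 2)) - Real.sqrt π / 2| ≤ Real.exp (-b ^ 2) := by
  have hint : ∀ a b : ℝ,
      IntervalIntegrable (fun r : ℝ ↦ Real.exp (-r ^ 2)) MeasureTheory.volume a b :=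
    fun a b ↦ (by fun_prop : Continuous fun r : ℝ ↦ Real.exp (-r ^ 2)).intervalIntegrable a b
  have hI : MeasureTheory.Integrable fun r : ℝ ↦ Real.exp (-r ^ 2) := by
    simpa using integrable_exp_neg_mul_sq (b := 1) one_pos
  have hval : ∫ r in Set.Ioi (0:ℝ), Real.exp (-r ^ 2) = Real.sqrt π / 2 := by
    simpa using integral_gaussian_Ioi 1
  have hlim :=
    MeasureTheory.intervalIntegral_tendsto_integral_Ioi (0 : ℝ) hI.integrableOn tendsto_id
  rw [hval] at hlim
  have hmono : ∀ x y : ℝ, x ≤ y →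
      (∫ r in (0:ℝ)..x, Real.exp (-r ^ 2)) ≤ ∫ r in (0:ℝ)..y, Real.exp (-r ^ 2) := by
    intro x y hxy
    rw [← intervalIntegral.integral_add_adjacent_intervals (hint 0 x) (hint x y)]
    have := intervalIntegral.integral_nonneg (μ := MeasureTheory.volume) hxy
      (fun r _ ↦ (Real.exp_pos (-r ^ 2)).le)
    linarith
  have hle : ∀ x : ℝ, (∫ r in (0:ℝ)..x, Real.exp (-r ^ 2)) ≤ Real.sqrt π / 2 := fun x ↦
    ge_of_tendsto hlim ((eventually_ge_atTop x).mono fun y hy ↦ hmono x y hy)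
  have hs : Real.sqrt π / 2 ≤ 1 := by
    have : Real.sqrt π ≤ 2 := Real.sqrt_le_iff.2 ⟨by norm_num, by linarith [Real.pi_le_four]⟩
    linarith
  have hub : Real.sqrt π / 2 ≤ (∫ r in (0:ℝ)..b, Real.exp (-r ^ 2)) + Real.exp (-b ^ 2) := by
    refine le_of_tendsto hlim ((eventually_ge_atTop b).mono fun y hy ↦ ?_)
    simp only [id_eq]
    rw [← intervalIntegral.integral_add_adjacent_intervals (hint 0 b) (hint b y)]
    gcongr
    have e := intervalIntegral.integral_comp_add_right (a := 0) (b := y - b)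
      (fun r : ℝ ↦ Real.exp (-r ^ 2)) b
    rw [zero_add, sub_add_cancel] at e
    rw [← e]
    calc ∫ r in (0:ℝ)..y - b, Real.exp (-(r + b) ^ 2)
        ≤ ∫ r in (0:ℝ)..y - b, Real.exp (-b ^ 2) * Real.exp (-r ^ 2) := by
          refine intervalIntegral.integral_mono_on (by linarith)
            ((by fun_prop : Continuous fun r : ℝ ↦ Real.exp (-(r + b) ^ 2)).intervalIntegrable _ _)
            ((hint _ _).const_mul _) fun r hr ↦ ?_
          rw [← Real.exp_add]
          apply Real.exp_le_exp.2
          nlinarith [mul_nonneg hr.1 hb]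
      _ = Real.exp (-b ^ 2) * ∫ r in (0:ℝ)..y - b, Real.exp (-r ^ 2) :=
          intervalIntegral.integral_const_mul _ _
      _ ≤ Real.exp (-b ^ 2) * 1 := by gcongr; exact (hle _).trans hs
      _ = _ := mul_one _
  rw [abs_le]
  constructor
  · linarith
  · linarith [hle b, Real.exp_pos (-b ^ 2)]

/-- An entire primitive of `exp (w ^ 2)` with control in the upper half plane. -/
lemma exists_primitive_exp_sq : ∃ E : ℂ → ℂ, (∀ w, HasDerivAt E (Complex.exp (w ^ 2)) w) ∧
    (∀ x : ℝ, (E x).im = 0) ∧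
    ∀ w : ℂ, 0 ≤ w.im → ‖E w - Real.sqrt π / 2 * Complex.I‖ ≤
      (|w.re| + 1) * ‖Complex.exp (w ^ 2)‖ := by
  have hd : Differentiable ℂ fun w : ℂ ↦ Complex.exp (w ^ 2) := by fun_prop
  obtain ⟨E, h0, hE⟩ := (Differentiable.isExactOn_univ hd).with_val_at 0 0
  replace hE : ∀ w, HasDerivAt E (Complex.exp (w ^ 2)) w := fun w ↦ hE w (Set.mem_univ _)
  refine ⟨E, hE, fun x ↦ ?_, fun w hw ↦ ?_⟩
  · have h1 := intervalIntegral.integral_eq_sub_of_hasDerivAt (a := 0) (b := x)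
      (f := fun r : ℝ ↦ E r) (f' := fun r : ℝ ↦ ((Real.exp (r ^ 2) : ℝ) : ℂ))
      (fun r _ ↦ by simpa using (hE (r : ℂ)).comp_ofReal)
      ((by fun_prop : Continuous fun r : ℝ ↦ ((Real.exp (r ^ 2) : ℝ) : ℂ)).intervalIntegrable _ _)
    rw [intervalIntegral.integral_ofReal] at h1
    simp only [Complex.ofReal_zero, h0, sub_zero] at h1
    rw [← h1, Complex.ofReal_im]
  · have h1 := intervalIntegral.integral_eq_sub_of_hasDerivAt (a := 0) (b := w.im)
      (f := fun r : ℝ ↦ E (Complex.I * r) * -Complex.I)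
      (f' := fun r : ℝ ↦ ((Real.exp (-r ^ 2) : ℝ) : ℂ))
      (fun r _ ↦ by
        have h2 := ((hE (Complex.I * r)).comp (r : ℂ)
          ((hasDerivAt_id (r : ℂ)).const_mul Complex.I)).comp_ofReal.mul_const (-Complex.I)
        have e : Complex.exp ((Complex.I * r) ^ 2) * (Complex.I * 1) * -Complex.I =
            ((Real.exp (-r ^ 2) : ℝ) : ℂ) := by
          push_cast
          rw [mul_pow, Complex.I_sq, neg_one_mul]
          linear_combination (-Complex.exp (-(r:ℂ) ^ 2)) * Complex.I_mul_I
        rw [e] at h2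
        exact h2)
      ((by fun_prop : Continuous fun r : ℝ ↦ ((Real.exp (-r ^ 2) : ℝ) : ℂ)).intervalIntegrable _ _)
    rw [intervalIntegral.integral_ofReal] at h1
    simp only [Complex.ofReal_zero, mul_zero, h0, zero_mul, sub_zero] at h1
    have hb : ‖E (Complex.I * w.im) - Real.sqrt π / 2 * Complex.I‖ ≤ Real.exp (-w.im ^ 2) := by
      have e : E (Complex.I * w.im) - Real.sqrt π / 2 * Complex.I =
          Complex.I * (((∫ r in (0:ℝ)..w.im, Real.exp (-r ^ 2)) - Real.sqrt π / 2 : ℝ) : ℂ) := by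
        push_cast
        rw [h1]
        linear_combination E (Complex.I * w.im) * Complex.I_mul_I
      rw [e, norm_mul, Complex.norm_I, one_mul, Complex.norm_real]
      exact gaussian_tail hw
    have hnorm : ∀ z : ℂ, ‖Complex.exp (z ^ 2)‖ = Real.exp (z.re ^ 2 - z.im ^ 2) := by
      intro z
      rw [Complex.norm_exp, sq, Complex.mul_re]; ring_nf
    have hseg : ‖E w - E (Complex.I * w.im)‖ ≤ ‖Complex.exp (w ^ 2)‖ * ‖w - Complex.I * w.im‖ := by
      refine Convex.norm_image_sub_le_of_norm_hasDerivWithin_le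
        (s := {z : ℂ | |z.re| ≤ |w.re|} ∩ {z : ℂ | z.im = w.im}) (f := E)
        (fun z hz ↦ (hE z).hasDerivWithinAt) (fun z hz ↦ ?_) ?_ ?_ ?_
      · obtain ⟨h1, h2⟩ := hz
        rw [hnorm, hnorm]
        apply Real.exp_le_exp.2
        simp only [Set.mem_ofPred_eq] at h1 h2
        rw [h2]
        have := sq_le_sq.2 h1
        linarith
      · apply Convex.inter
        · have : {z : ℂ | |z.re| ≤ |w.re|} = Complex.reLm ⁻¹' (Set.Icc (-|w.re|) |w.re|) := by
            ext z; simp [abs_le]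
          rw [this]
          exact (convex_Icc _ _).linear_preimage _
        · have : {z : ℂ | z.im = w.im} = Complex.imLm ⁻¹' {w.im} := by ext z; simp
          rw [this]
          exact (convex_singleton _).linear_preimage _
      · simp
      · simp
    have hw' : ‖w - Complex.I * w.im‖ = |w.re| := by
      have : w - Complex.I * w.im = w.re := by
        nth_rewrite 1 [← Complex.re_add_im w]; ring
      rw [this, Complex.norm_real, Real.norm_eq_abs]
    rw [hw'] at hseg
    have hle : Real.exp (-w.im ^ 2) ≤ ‖Complex.exp (w ^ 2)‖ := by
      rw [hnorm]; apply Real.exp_le_exp.2; nlinarith [sq_nonneg w.re]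
    calc _ = ‖(E w - E (Complex.I * w.im)) +
            (E (Complex.I * w.im) - Real.sqrt π / 2 * Complex.I)‖ := by
          congr 1; ring
      _ ≤ _ := norm_add_le _ _
      _ ≤ _ := by linarith

lemma hasDerivAt_sqrt_complex {z : ℂ} (hz : z ∈ Complex.slitPlane) :
    HasDerivAt Complex.sqrt ((Complex.sqrt z)⁻¹ / 2) z := by
  have h := Complex.hasDerivAt_sqrt hz
  rwa [show (-1 / 2 : ℂ) = -2⁻¹ by norm_num, Complex.cpow_neg, ← Complex.sqrt] at h

/-- An antiderivative of `2 b² u² exp (b² u² + a² / u²)` when `E` is one of `exp (w²)`. -/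
noncomputable def besselPrimitive (E : ℂ → ℂ) (a b : ℝ) (u : ℂ) : ℂ :=
  u * Complex.exp (b ^ 2 * u ^ 2 + a ^ 2 / u ^ 2) +
      Complex.exp (2 * a * b) * E (b * u - a / u) * (a - 1 / (2 * b)) -
      Complex.exp (-(2 * a * b)) * E (b * u + a / u) * (a + 1 / (2 * b))

lemma hasDerivAt_bessel_primitive {E : ℂ → ℂ} (hE : ∀ w, HasDerivAt E (Complex.exp (w ^ 2)) w)
    {a b : ℝ} (hb : b ≠ 0) {u : ℂ} (hu : u ≠ 0) :
    HasDerivAt (besselPrimitive E a b)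
      (2 * b ^ 2 * u ^ 2 * Complex.exp (b ^ 2 * u ^ 2 + a ^ 2 / u ^ 2)) u := by
  have hb' : (b : ℂ) ≠ 0 := by exact_mod_cast hb
  have hinv : HasDerivAt (fun u : ℂ ↦ (a : ℂ) / u) (-a / u ^ 2) u := by
    have := (hasDerivAt_inv hu).const_mul (a : ℂ)
    simp only [div_eq_mul_inv]
    refine this.congr_deriv ?_
    ring
  have hinv2 : HasDerivAt (fun u : ℂ ↦ (a : ℂ) ^ 2 / u ^ 2) (-2 * a ^ 2 / u ^ 3) u := by
    have e : (fun u : ℂ ↦ (a : ℂ) ^ 2 / u ^ 2) = (fun u : ℂ ↦ (a : ℂ) / u) ^ 2 := by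
      ext v; simp [div_pow]
    rw [e]
    refine (hinv.pow 2).congr_deriv ?_
    push_cast
    field_simp
  have hlin : HasDerivAt (fun u : ℂ ↦ (b : ℂ) * u) b u := by
    simpa using (hasDerivAt_id u).const_mul (b : ℂ)
  have hsq : HasDerivAt (fun u : ℂ ↦ (b : ℂ) ^ 2 * u ^ 2) (b ^ 2 * (2 * u)) u := by
    simpa using ((hasDerivAt_id u).pow 2).const_mul ((b : ℂ) ^ 2)
  have h1 := (hasDerivAt_id u).mul (hsq.add hinv2).cexp
  have h2 := (((hE (b * u - a / u)).comp u (hlin.sub hinv)).const_mul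
    (Complex.exp (2 * a * b))).mul_const ((a : ℂ) - 1 / (2 * b))
  have h3 := (((hE (b * u + a / u)).comp u (hlin.add hinv)).const_mul
    (Complex.exp (-(2 * a * b)))).mul_const ((a : ℂ) + 1 / (2 * b))
  refine ((h1.add h2).sub h3).congr_deriv ?_
  have e2 : Complex.exp (2 * a * b) * Complex.exp ((b * u - a / u) ^ 2) =
      Complex.exp (b ^ 2 * u ^ 2 + a ^ 2 / u ^ 2) := by
    rw [← Complex.exp_add]; congr 1; field_simp; ring
  have e3 : Complex.exp (-(2 * a * b)) * Complex.exp ((b * u + a / u) ^ 2) =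
      Complex.exp (b ^ 2 * u ^ 2 + a ^ 2 / u ^ 2) := by
    rw [← Complex.exp_add]; congr 1; field_simp; ring
  have e2' : Complex.exp (2 * a * b) * (Complex.exp ((b * u - a / u) ^ 2) * (b - -a / u ^ 2)) *
      (a - 1 / (2 * b)) = Complex.exp (b ^ 2 * u ^ 2 + a ^ 2 / u ^ 2) * (b - -a / u ^ 2) *
      (a - 1 / (2 * b)) := by rw [← e2]; ring
  have e3' : Complex.exp (-(2 * a * b)) * (Complex.exp ((b * u + a / u) ^ 2) * (b + -a / u ^ 2)) *
      (a + 1 / (2 * b)) = Complex.exp (b ^ 2 * u ^ 2 + a ^ 2 / u ^ 2) * (b + -a / u ^ 2) *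
      (a + 1 / (2 * b)) := by rw [← e3]; ring
  rw [e2', e3']
  simp only [id_eq, Pi.add_apply]
  generalize Complex.exp (b ^ 2 * u ^ 2 + a ^ 2 / u ^ 2) = G
  field_simp
  ring

lemma add_mul_I_mem_slitPlane {y : ℝ} (hy : 0 < y) (x : ℂ) (hx : x.im = 0) :
    y + x * Complex.I ∈ Complex.slitPlane := by
  left; simpa [hx] using hy

lemma sqrt_ne_zero_of_ne {s : ℂ} (hs : s ≠ 0) : Complex.sqrt s ≠ 0 := by
  intro h; apply hs; rw [← complex_sqrt_sq s, h]; simp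

lemma continuous_bessel_integrand (a b : ℝ) {y : ℝ} (hy : 0 < y) :
    Continuous fun x : ℝ ↦ Complex.sqrt (y + x * Complex.I) *
      Complex.exp (a ^ 2 / (y + x * Complex.I) + b ^ 2 * (y + x * Complex.I)) := by
  have h0 : ∀ x : ℝ, (y + x * Complex.I : ℂ) ≠ 0 := fun x h ↦ by
    have := congrArg Complex.re h
    exact hy.ne' (by simpa using this)
  have h1 : Continuous fun x : ℝ ↦ Complex.sqrt (y + x * Complex.I) :=
    Complex.continuousOn_sqrt.comp_continuous (by fun_prop)
      fun x ↦ add_mul_I_mem_slitPlane hy x (Complex.ofReal_im x)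
  have h2 : Continuous fun x : ℝ ↦ (a : ℂ) ^ 2 / (y + x * Complex.I) :=
    continuous_const.div (by fun_prop) h0
  fun_prop

lemma im_besselPrimitive_sqrt {E : ℂ → ℂ} (hE : ∀ x : ℝ, (E x).im = 0) (a b : ℝ) {y : ℝ}
    (hy : 0 < y) :
    (besselPrimitive E a b (Complex.sqrt (y + (0 : ℝ) * Complex.I))).im = 0 := by
  have e : Complex.sqrt (y + (0 : ℝ) * Complex.I) = (Real.sqrt y : ℂ) := by
    have := sqrt_ofReal_mul (s := 1) hy one_ne_zero
    simpa using this
  rw [e, besselPrimitive]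
  have r1 : (Real.sqrt y * Complex.exp (b ^ 2 * Real.sqrt y ^ 2 + a ^ 2 / Real.sqrt y ^ 2) : ℂ) =
    ((Real.sqrt y * Real.exp (b ^ 2 * Real.sqrt y ^ 2 + a ^ 2 / Real.sqrt y ^ 2) : ℝ) : ℂ) := by
    push_cast; rfl
  have r2 : (Complex.exp (2 * a * b) : ℂ) = ((Real.exp (2 * a * b) : ℝ) : ℂ) := by push_cast; rfl
  have r3 : (Complex.exp (-(2 * a * b)) : ℂ) = ((Real.exp (-(2 * a * b)) : ℝ) : ℂ) := by
    push_cast; rfl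
  have r4 : (a - 1 / (2 * b) : ℂ) = ((a - 1 / (2 * b) : ℝ) : ℂ) := by push_cast; rfl
  have r5 : (a + 1 / (2 * b) : ℂ) = ((a + 1 / (2 * b) : ℝ) : ℂ) := by push_cast; rfl
  have r6 : (b * Real.sqrt y - a / Real.sqrt y : ℂ) =
      ((b * Real.sqrt y - a / Real.sqrt y : ℝ) : ℂ) := by
    push_cast; rfl
  have r7 : (b * Real.sqrt y + a / Real.sqrt y : ℂ) =
      ((b * Real.sqrt y + a / Real.sqrt y : ℝ) : ℂ) := by
    push_cast; rfl
  rw [r1, r2, r3, r4, r5, r6, r7, Complex.sub_im, Complex.add_im, Complex.ofReal_im,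
    Complex.im_mul_ofReal, Complex.im_mul_ofReal, Complex.im_ofReal_mul, Complex.im_ofReal_mul,
    hE, hE]
  ring

set_option maxHeartbeats 1000000 in
lemma abs_im_besselPrimitive_sub_le {E : ℂ → ℂ}
    (hEb : ∀ w, 0 ≤ w.im →
      ‖E w - Real.sqrt π / 2 * Complex.I‖ ≤ (|w.re| + 1) * ‖Complex.exp (w ^ 2)‖)
    {a b y : ℝ} (ha : 0 < a) (ha1 : a ≤ 13 / 25) (hb : 10 ≤ b) (hy : 0 < y) (hy1 : y ≤ 1 / 100) :
    |2 * (besselPrimitive E a b (Complex.sqrt (y + (1 / 2 : ℝ) * Complex.I))).im -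
      Real.sqrt π * (a - 1 / (2 * b)) * Real.exp (2 * a * b)| ≤
      (3 * b + 8) * Real.exp (b ^ 2 * y + 4 * a ^ 2 * y) := by
  have hb0 : b ≠ 0 := by positivity
  set s : ℂ := y + (1 / 2 : ℝ) * Complex.I with hs
  have hsre : s.re = y := by simp [hs]
  have hsim : s.im = 1 / 2 := by simp [hs]
  set u := Complex.sqrt s with hu
  have hs0 : s ≠ 0 := by intro h; rw [h] at hsim; simp at hsim
  have hu0 : u ≠ 0 := sqrt_ne_zero_of_ne hs0
  have husq : u ^ 2 = s := complex_sqrt_sq s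
  have hsn1 : ‖s‖ ≤ 1 := by
    refine (Complex.norm_le_abs_re_add_abs_im s).trans ?_
    rw [hsre, hsim, abs_of_pos hy, abs_of_pos (by norm_num)]
    linarith
  have hsn2 : 1 / 2 ≤ ‖s‖ := by
    have := Complex.abs_im_le_norm s
    rwa [hsim, abs_of_pos (by norm_num)] at this
  have hun : ‖u‖ ^ 2 = ‖s‖ := by rw [← norm_pow, husq]
  have hun1 : ‖u‖ ≤ 1 := by nlinarith [norm_nonneg u]
  have hun2 : 7 / 10 ≤ ‖u‖ := by nlinarith [norm_nonneg u]
  have huim : 0 ≤ u.im := by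
    have h1 : u.im = (Complex.sqrt s).im := rfl
    rw [h1, Complex.sqrt_eq_real_add_ite, if_pos (by rw [hsim]; norm_num)]
    simp
    positivity
  have hauim : (a / u : ℂ).im = - (a * u.im / ‖s‖) := by
    rw [div_eq_mul_inv, Complex.im_ofReal_mul, Complex.inv_im, Complex.normSq_eq_norm_sq, hun]; ring
  have hau : ‖(a / u : ℂ)‖ ≤ 3 / 4 := by
    rw [norm_div, Complex.norm_real, Real.norm_of_nonneg ha.le, div_le_iff₀ (by linarith)]
    linarith
  have hbu : ‖(b * u : ℂ)‖ ≤ b := by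
    rw [norm_mul, Complex.norm_real, Real.norm_of_nonneg (by linarith)]
    nlinarith
  have haun : a * u.im / ‖s‖ ≤ 2 * (a * u.im) := by
    rw [div_le_iff₀ (by linarith)]
    nlinarith [mul_nonneg ha.le huim]
  have hm := hEb (b * u - a / u) (by
    rw [Complex.sub_im, hauim, Complex.im_ofReal_mul]
    have : 0 ≤ a * u.im / ‖s‖ := by positivity
    nlinarith)
  have hp := hEb (b * u + a / u) (by
    rw [Complex.add_im, hauim, Complex.im_ofReal_mul]
    nlinarith)
  have hrem : |(b * u - a / u : ℂ).re| ≤ b + 3 / 4 :=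
    (Complex.abs_re_le_norm _).trans ((norm_sub_le _ _).trans (by linarith))
  have hrep : |(b * u + a / u : ℂ).re| ≤ b + 3 / 4 :=
    (Complex.abs_re_le_norm _).trans ((norm_add_le _ _).trans (by linarith))
  set G := ‖Complex.exp (b ^ 2 * u ^ 2 + a ^ 2 / u ^ 2)‖ with hG
  have hGval : G = Real.exp (b ^ 2 * y + a ^ 2 * y / ‖s‖ ^ 2) := by
    rw [hG, Complex.norm_exp, husq, Complex.add_re, div_eq_mul_inv,
      show ((b : ℂ) ^ 2) = ((b ^ 2 : ℝ) : ℂ) by push_cast; rfl,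
      show ((a : ℂ) ^ 2) = ((a ^ 2 : ℝ) : ℂ) by push_cast; rfl, Complex.re_ofReal_mul,
      Complex.re_ofReal_mul, Complex.inv_re, hsre, Complex.normSq_eq_norm_sq]
    ring_nf
  have hG1 : 1 ≤ G := by rw [hGval]; apply Real.one_le_exp; positivity
  have hGle : G ≤ Real.exp (b ^ 2 * y + 4 * a ^ 2 * y) := by
    rw [hGval]
    apply Real.exp_le_exp.2
    gcongr
    rw [div_le_iff₀ (by positivity)]
    have : 1 / 4 ≤ ‖s‖ ^ 2 := by nlinarith
    nlinarith [mul_pos (pow_pos ha 2) hy]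
  have gm : Real.exp (2 * a * b) * ‖Complex.exp ((b * u - a / u) ^ 2)‖ = G := by
    have e : Real.exp (2 * a * b) = ‖Complex.exp (2 * a * b)‖ := by
      rw [← Complex.norm_exp_ofReal]
      push_cast
      rfl
    rw [e, ← norm_mul, ← Complex.exp_add, hG]
    congr 2; field_simp; ring
  have gp : Real.exp (-(2 * a * b)) * ‖Complex.exp ((b * u + a / u) ^ 2)‖ = G := by
    have e : Real.exp (-(2 * a * b)) = ‖Complex.exp (-(2 * a * b))‖ := by
      rw [← Complex.norm_exp_ofReal]
      push_cast
      rfl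
    rw [e, ← norm_mul, ← Complex.exp_add, hG]
    congr 2; field_simp; ring
  set em := E (b * u - a / u) - Real.sqrt π / 2 * Complex.I with hem
  set ep := E (b * u + a / u) - Real.sqrt π / 2 * Complex.I with hep
  have hX := Real.exp_pos (2 * a * b)
  have hX' := Real.exp_pos (-(2 * a * b))
  have hem' : Real.exp (2 * a * b) * ‖em‖ ≤ (b + 7 / 4) * G := by
    calc _ ≤ Real.exp (2 * a * b) * ((b + 3 / 4 + 1) * ‖Complex.exp ((b * u - a / u) ^ 2)‖) := by
          gcongr; refine hm.trans ?_; gcongr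
      _ = _ := by rw [← gm]; ring
  have hep' : Real.exp (-(2 * a * b)) * ‖ep‖ ≤ (b + 7 / 4) * G := by
    calc _ ≤ Real.exp (-(2 * a * b)) * ((b + 3 / 4 + 1) * ‖Complex.exp ((b * u + a / u) ^ 2)‖) := by
          gcongr; refine hp.trans ?_; gcongr
      _ = _ := by rw [← gp]; ring
  have hPu : besselPrimitive E a b u = u * Complex.exp (b ^ 2 * u ^ 2 + a ^ 2 / u ^ 2) +
      ((Real.exp (2 * a * b) * (a - 1 / (2 * b)) : ℝ) : ℂ) * em -
      ((Real.exp (-(2 * a * b)) * (a + 1 / (2 * b)) : ℝ) : ℂ) * ep +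
      ((Real.sqrt π / 2 * (Real.exp (2 * a * b) * (a - 1 / (2 * b)) -
        Real.exp (-(2 * a * b)) * (a + 1 / (2 * b))) : ℝ) : ℂ) * Complex.I := by
    rw [besselPrimitive, hem, hep]
    push_cast
    ring
  set T1 := u * Complex.exp (b ^ 2 * u ^ 2 + a ^ 2 / u ^ 2) with hT1
  have hT1n : ‖T1‖ ≤ G := by
    rw [hT1, norm_mul, ← hG]; nlinarith
  have hc0 : 1 / (2 * b) ≤ 1 / 20 := by
    apply one_div_le_one_div_of_le <;> linarith
  have hc0' : 0 < 1 / (2 * b) := by positivity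
  set T2 := ((Real.exp (2 * a * b) * (a - 1 / (2 * b)) : ℝ) : ℂ) * em with hT2
  have hT2n : ‖T2‖ ≤ 13 / 25 * ((b + 7 / 4) * G) := by
    rw [hT2, norm_mul, Complex.norm_real, Real.norm_eq_abs, abs_mul, abs_of_pos hX]
    have : |a - 1 / (2 * b)| ≤ 13 / 25 := by rw [abs_le]; constructor <;> linarith
    calc _ = |a - 1 / (2 * b)| * (Real.exp (2 * a * b) * ‖em‖) := by ring
      _ ≤ _ := by gcongr
  set T3 := ((Real.exp (-(2 * a * b)) * (a + 1 / (2 * b)) : ℝ) : ℂ) * ep with hT3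
  have hT3n : ‖T3‖ ≤ 57 / 100 * ((b + 7 / 4) * G) := by
    rw [hT3, norm_mul, Complex.norm_real, Real.norm_eq_abs, abs_mul, abs_of_pos hX']
    have : |a + 1 / (2 * b)| ≤ 57 / 100 := by rw [abs_le]; constructor <;> linarith
    calc _ = |a + 1 / (2 * b)| * (Real.exp (-(2 * a * b)) * ‖ep‖) := by ring
      _ ≤ _ := by gcongr
  have hPim : (besselPrimitive E a b u).im = T1.im + T2.im - T3.im +
      Real.sqrt π / 2 * (Real.exp (2 * a * b) * (a - 1 / (2 * b)) -
        Real.exp (-(2 * a * b)) * (a + 1 / (2 * b))) := by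
    rw [hPu, Complex.add_im, Complex.sub_im, Complex.add_im, Complex.im_ofReal_mul _ Complex.I,
      Complex.I_im, mul_one]
  have i1 := abs_le.1 ((Complex.abs_im_le_norm T1).trans hT1n)
  have i2 := abs_le.1 ((Complex.abs_im_le_norm T2).trans hT2n)
  have i3 := abs_le.1 ((Complex.abs_im_le_norm T3).trans hT3n)
  have hsm : Real.exp (-(2 * a * b)) ≤ 1 := Real.exp_le_one_iff.2 (by
    have : 0 ≤ 2 * a * b := by positivity
    linarith)
  have hsp : Real.sqrt π ≤ 2 := Real.sqrt_le_iff.2 ⟨by norm_num, by linarith [Real.pi_le_four]⟩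
  have i4 : Real.sqrt π * (Real.exp (-(2 * a * b)) * (a + 1 / (2 * b))) ≤ 57 / 50 := by
    calc Real.sqrt π * (Real.exp (-(2 * a * b)) * (a + 1 / (2 * b))) ≤
          2 * (1 * (13 / 25 + 1 / 20)) := by gcongr
      _ = 57 / 50 := by norm_num
  have i4' : 0 ≤ Real.sqrt π * (Real.exp (-(2 * a * b)) * (a + 1 / (2 * b))) := by positivity
  have hfin : (3 * b + 8) * G ≤ (3 * b + 8) * Real.exp (b ^ 2 * y + 4 * a ^ 2 * y) := by gcongr
  have hbG : 0 ≤ b * G := by positivity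
  have heq : 2 * (besselPrimitive E a b u).im -
        Real.sqrt π * (a - 1 / (2 * b)) * Real.exp (2 * a * b) =
      2 * T1.im + 2 * T2.im - 2 * T3.im -
        Real.sqrt π * (Real.exp (-(2 * a * b)) * (a + 1 / (2 * b))) := by
    rw [hPim]; ring
  rw [heq]
  refine le_trans ?_ hfin
  rw [abs_le]
  constructor <;> linarith

lemma integral_bessel {a b y : ℝ} (ha : 0 < a) (ha1 : a ≤ 13 / 25) (hb : 10 ≤ b) (hy : 0 < y)
    (hy1 : y ≤ 1 / 100) :
    |b ^ 2 * (2 * (∫ x in (0:ℝ)..1 / 2, Complex.sqrt (y + x * Complex.I) *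
      Complex.exp (a ^ 2 / (y + x * Complex.I) + b ^ 2 * (y + x * Complex.I))).re) -
      Real.sqrt π * (a - 1 / (2 * b)) * Real.exp (2 * a * b)| ≤
      (3 * b + 8) * Real.exp (b ^ 2 * y + 4 * a ^ 2 * y) := by
  obtain ⟨E, hE, hEre, hEb⟩ := exists_primitive_exp_sq
  have hb0 : b ≠ 0 := by positivity
  set P : ℂ → ℂ := besselPrimitive E a b with hP
  have hint := intervalIntegral.integral_eq_sub_of_hasDerivAt (a := 0) (b := 1 / 2)
    (f := fun x : ℝ ↦ P (Complex.sqrt (y + x * Complex.I)))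
    (f' := fun x : ℝ ↦ Complex.I * b ^ 2 * (Complex.sqrt (y + x * Complex.I) *
      Complex.exp (a ^ 2 / (y + x * Complex.I) + b ^ 2 * (y + x * Complex.I))))
    (fun x _ ↦ by
      have hsl := add_mul_I_mem_slitPlane hy (x : ℂ) (Complex.ofReal_im x)
      have hs0 := Complex.slitPlane_ne_zero hsl
      have hu0 := sqrt_ne_zero_of_ne hs0
      have h1 : HasDerivAt (fun z : ℂ ↦ (y + z * Complex.I : ℂ)) Complex.I (x : ℂ) := by
        simpa using ((hasDerivAt_id (x : ℂ)).mul_const Complex.I).const_add (y : ℂ)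
      have h2 := (((hasDerivAt_bessel_primitive hE (a := a) hb0 hu0).comp (x : ℂ)
        ((hasDerivAt_sqrt_complex hsl).comp (x : ℂ) h1))).comp_ofReal
      refine h2.congr_deriv ?_
      have hsq := complex_sqrt_sq (y + x * Complex.I)
      simp only [hsq]
      rw [show ∀ G : ℂ, 2 * (b : ℂ) ^ 2 * (y + x * Complex.I) * G =
        2 * (b : ℂ) ^ 2 * (Complex.sqrt (y + x * Complex.I)) ^ 2 * G by rw [hsq]; intro G; rfl,
        add_comm (_ / _)]
      field_simp)
    ((continuous_const.mul (continuous_bessel_integrand a b hy)).intervalIntegrable _ _)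
  rw [intervalIntegral.integral_const_mul] at hint
  set J := ∫ x in (0:ℝ)..1 / 2, Complex.sqrt (y + x * Complex.I) *
      Complex.exp (a ^ 2 / (y + x * Complex.I) + b ^ 2 * (y + x * Complex.I)) with hJ
  have hbase := im_besselPrimitive_sqrt hEre a b hy
  have hmain : b ^ 2 * J.re = (P (Complex.sqrt (y + (1 / 2 : ℝ) * Complex.I))).im := by
    have := congrArg Complex.im hint
    rw [Complex.sub_im, hbase, sub_zero] at this
    rw [← this, mul_assoc, Complex.I_mul_im,
      show ((b : ℂ) ^ 2) = ((b ^ 2 : ℝ) : ℂ) by push_cast; rfl,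
      Complex.re_ofReal_mul]
  have := abs_im_besselPrimitive_sub_le hEb ha ha1 hb hy hy1
  rwa [← hmain, show 2 * (b ^ 2 * J.re) = b ^ 2 * (2 * J.re) by ring] at this

lemma re_integral_exp_two_pi_int (k : ℤ) :
    (∫ x in (0:ℝ)..1 / 2, Complex.exp (2 * π * k * Complex.I * x)).re =
      if k = 0 then 1 / 2 else 0 := by
  split_ifs with hk
  · simp [hk]
  · have hc : (2 * π * k * Complex.I : ℂ) ≠ 0 := by
      simp [Complex.ofReal_ne_zero.2 Real.pi_ne_zero, hk]
    rw [integral_exp_mul_complex hc]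
    have e : (2 * π * k * Complex.I * (1 / 2 : ℝ) : ℂ) = ((π * k : ℝ) : ℂ) * Complex.I := by
      push_cast; ring
    rw [e, Complex.exp_mul_I, ← Complex.ofReal_cos, ← Complex.ofReal_sin,
      mul_comm π (k : ℝ), Real.sin_int_mul_pi,
      show (2 * π * k * Complex.I : ℂ) = ((2 * π * k : ℝ) : ℂ) * Complex.I by push_cast; ring]
    have : (((Real.cos (k * π) : ℝ) : ℂ) + ((0 : ℝ) : ℂ) * Complex.I -
        Complex.exp (((2 * π * k : ℝ) : ℂ) * Complex.I * ((0 : ℝ) : ℂ))) /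
          (((2 * π * k : ℝ) : ℂ) * Complex.I) =
        (((1 - Real.cos (k * π)) / (2 * π * k) : ℝ) : ℂ) * Complex.I := by
      have : (2 * π * k : ℂ) ≠ 0 := by simpa using hc
      simp only [Complex.ofReal_zero, mul_zero, Complex.exp_zero, zero_mul, add_zero]
      push_cast
      field_simp
      linear_combination (Complex.cos (k * π) - 1) * Complex.I_sq
    rw [this, Complex.re_ofReal_mul, Complex.I_re, mul_zero]

lemma norm_exp_neg_two_pi_line (x y : ℝ) :
    ‖Complex.exp (-(2 * π * (y + x * Complex.I)))‖ = Real.exp (-(2 * π * y)) := by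
  rw [norm_exp_neg_two_pi]; simp

lemma norm_p_mul_exp_pow (x y : ℝ) (m : ℕ) :
    ‖(p m : ℂ) * Complex.exp (-(2 * π * (y + x * Complex.I))) ^ m‖ =
      p m * Real.exp (-(2 * π * y)) ^ m := by
  rw [norm_mul, norm_pow, norm_exp_neg_two_pi_line, Complex.norm_real,
    Real.norm_of_nonneg (p_nonneg m)]

lemma summable_p_exp {y : ℝ} (hy : 0 < y) : Summable fun m ↦ p m * Real.exp (-(2 * π * y)) ^ m :=
  summable_p (Real.exp_pos _).le (Real.exp_lt_one_iff.2 (by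
    have := mul_pos Real.pi_pos hy
    linarith))

lemma continuous_partitionGenFun_line {y : ℝ} (hy : 0 < y) :
    Continuous fun x : ℝ ↦ partitionGenFun (y + x * Complex.I) := by
  have h : (fun x : ℝ ↦ partitionGenFun (y + x * Complex.I)) =
      fun x : ℝ ↦ ∑' m, (p m : ℂ) * Complex.exp (-(2 * π * (y + x * Complex.I))) ^ m := by
    ext x
    exact (hasSum_partitionGenFun (by simpa using hy)).tsum_eq.symm
  rw [h]
  exact continuous_tsum (fun m ↦ by fun_prop) (summable_p_exp hy)
    fun m x ↦ (norm_p_mul_exp_pow x y m).le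

lemma p_eq_integral (n : ℕ) {y : ℝ} (hy : 0 < y) :
    p n = 2 * (∫ x in (0:ℝ)..1 / 2, partitionGenFun (y + x * Complex.I) *
      Complex.exp (2 * π * n * (y + x * Complex.I))).re := by
  have hnorm : ∀ x : ℝ, ‖Complex.exp (2 * π * n * (y + x * Complex.I))‖ =
      Real.exp (2 * π * n * y) := fun x ↦ by
    rw [Complex.norm_exp]
    congr 1
    simp
  have hS := (summable_p_exp hy).mul_right (Real.exp (2 * π * n * y))
  have h := intervalIntegral.hasSum_integral_of_dominated_convergence (a := 0) (b := 1 / 2)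
    (μ := MeasureTheory.volume)
    (F := fun m (x : ℝ) ↦ (p m : ℂ) * Complex.exp (-(2 * π * (y + x * Complex.I))) ^ m *
      Complex.exp (2 * π * n * (y + x * Complex.I)))
    (f := fun x : ℝ ↦ partitionGenFun (y + x * Complex.I) *
      Complex.exp (2 * π * n * (y + x * Complex.I)))
    (fun m _ ↦ p m * Real.exp (-(2 * π * y)) ^ m * Real.exp (2 * π * n * y))
    (fun m ↦ (by fun_prop : Continuous fun x : ℝ ↦
      (p m : ℂ) * Complex.exp (-(2 * π * (y + x * Complex.I))) ^ m *
      Complex.exp (2 * π * n * (y + x * Complex.I))).aestronglyMeasurable)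
    (fun m ↦ Eventually.of_forall fun x _ ↦ by
      rw [norm_mul, norm_p_mul_exp_pow, hnorm])
    (Eventually.of_forall fun x _ ↦ hS)
    (continuous_const.intervalIntegrable _ _)
    (Eventually.of_forall fun x _ ↦
      (hasSum_partitionGenFun (by simpa using hy)).mul_right _)
  have hre := Complex.hasSum_re h
  have hterm : ∀ m : ℕ, (∫ x in (0:ℝ)..1 / 2,
      (p m : ℂ) * Complex.exp (-(2 * π * (y + x * Complex.I))) ^ m *
      Complex.exp (2 * π * n * (y + x * Complex.I))).re = if m = n then p n / 2 else 0 := by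
    intro m
    have e : ∀ x : ℝ, (p m : ℂ) * Complex.exp (-(2 * π * (y + x * Complex.I))) ^ m *
        Complex.exp (2 * π * n * (y + x * Complex.I)) =
        ((p m * Real.exp (2 * π * (n - m) * y) : ℝ) : ℂ) *
          Complex.exp (2 * π * ((n - m : ℤ) : ℂ) * Complex.I * x) := by
      intro x
      rw [← Complex.exp_nat_mul, Complex.ofReal_mul, Complex.ofReal_exp, mul_assoc (p m : ℂ),
        mul_assoc (p m : ℂ), ← Complex.exp_add, ← Complex.exp_add]
      congr 2
      push_cast
      ring
    simp_rw [e]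
    rw [intervalIntegral.integral_const_mul, Complex.re_ofReal_mul, re_integral_exp_two_pi_int]
    by_cases hmn : m = n
    · subst hmn; simp; ring
    · rw [if_neg hmn, if_neg (by omega), mul_zero]
  rw [show (fun m ↦ (∫ x in (0:ℝ)..1 / 2,
      (p m : ℂ) * Complex.exp (-(2 * π * (y + x * Complex.I))) ^ m *
      Complex.exp (2 * π * n * (y + x * Complex.I))).re) = fun m ↦ if m = n then p n / 2 else 0
    from funext hterm] at hre
  rw [hre.unique (hasSum_ite_eq n (p n / 2))]
  ring

lemma sqrt_conj {s : ℂ} (hs : s ∈ Complex.slitPlane) :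
    Complex.sqrt (starRingEnd ℂ s) = starRingEnd ℂ (Complex.sqrt s) := by
  have h := Complex.conj_cpow s (2⁻¹ : ℂ) (Complex.slitPlane_arg_ne_pi hs)
  rw [Complex.sqrt, Complex.sqrt, h, map_inv₀, map_ofNat]

/-- The integrand of the contour integral of a modified Bessel function of order `3/2`. -/
noncomputable def besselIntegrand (a b y x : ℝ) : ℂ :=
  Complex.sqrt (y + x * Complex.I) *
    Complex.exp (a ^ 2 / (y + x * Complex.I) + b ^ 2 * (y + x * Complex.I))

lemma besselIntegrand_neg (a b : ℝ) {y : ℝ} (hy : 0 < y) (x : ℝ) :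
    besselIntegrand a b y (-x) = starRingEnd ℂ (besselIntegrand a b y x) := by
  have e : (y + (-x : ℝ) * Complex.I : ℂ) = starRingEnd ℂ (y + x * Complex.I) := by
    simp
  rw [besselIntegrand, besselIntegrand, e,
    sqrt_conj (add_mul_I_mem_slitPlane hy x (Complex.ofReal_im x)), map_mul, ← Complex.exp_conj]
  simp only [map_add, map_div₀, map_mul, map_pow, Complex.conj_ofReal]

lemma re_integral_besselIntegrand_shift (a b : ℝ) {y : ℝ} (hy : 0 < y) :
    (∫ x in (0:ℝ)..1 / 2, besselIntegrand a b y (x - 1 / 2)).re =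
      (∫ x in (0:ℝ)..1 / 2, besselIntegrand a b y x).re := by
  rw [intervalIntegral.integral_comp_sub_right (fun x ↦ besselIntegrand a b y x)]
  have h := intervalIntegral.integral_comp_neg (a := 0) (b := 1 / 2)
    (fun x ↦ besselIntegrand a b y x)
  rw [show (0 - 1 / 2 : ℝ) = -(1 / 2) by norm_num, show (1 / 2 - 1 / 2 : ℝ) = -0 by norm_num, ← h]
  simp_rw [besselIntegrand_neg a b hy]
  rw [intervalIntegral.intervalIntegral_conj, Complex.conj_re]

lemma cuspZeroTerm_mul_exp {n : ℕ} {a b : ℝ} (ha : a ^ 2 = π / 12)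
    (hb : b ^ 2 = 2 * π * n - π / 12) (x y : ℝ) :
    cuspZeroTerm (y + x * Complex.I) * Complex.exp (2 * π * n * (y + x * Complex.I)) =
      besselIntegrand a b y x := by
  have ha' : (a : ℂ) ^ 2 = π / 12 := by exact_mod_cast congrArg Complex.ofReal ha
  have hb' : (b : ℂ) ^ 2 = 2 * π * n - π / 12 := by
    have := congrArg Complex.ofReal hb
    push_cast at this
    exact this
  rw [cuspZeroTerm, besselIntegrand, mul_assoc, ← Complex.exp_add, ha', hb']
  congr 2
  ring

lemma cuspHalfTerm_mul_exp {n : ℕ} {a b : ℝ} (ha : a ^ 2 = π / 48)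
    (hb : b ^ 2 = 2 * π * n - π / 12) (x y : ℝ) :
    cuspHalfTerm (y + (x - 1 / 2) * Complex.I) * Complex.exp (2 * π * n * (y + x * Complex.I)) =
      (((-1) ^ n * Real.sqrt 2 : ℝ) : ℂ) * besselIntegrand a b y (x - 1 / 2) := by
  have ha' : (a : ℂ) ^ 2 = π / 48 := by exact_mod_cast congrArg Complex.ofReal ha
  have hb' : (b : ℂ) ^ 2 = 2 * π * n - π / 12 := by
    have := congrArg Complex.ofReal hb
    push_cast at this
    exact this
  have h1 : Complex.exp (n * (π * Complex.I)) = (-1) ^ n := by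
    rw [Complex.exp_nat_mul, Complex.exp_pi_mul_I]
  rw [cuspHalfTerm, besselIntegrand, ha', hb']
  push_cast
  rw [← h1]
  set σ : ℂ := y + (x - 1 / 2) * Complex.I with hσ
  have e : Complex.exp (2 * π * n * (y + x * Complex.I)) =
      Complex.exp (n * (π * Complex.I)) * Complex.exp (2 * π * n * σ) := by
    rw [← Complex.exp_add, hσ]
    congr 1
    ring
  have e2 : Complex.exp (π / 48 / σ + (2 * π * n - π / 12) * σ) =
      Complex.exp (π / 12 * ((4 * σ)⁻¹ - σ)) * Complex.exp (2 * π * n * σ) := by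
    rw [← Complex.exp_add, mul_inv]
    congr 1
    ring
  rw [e, e2]
  ring

lemma abs_p_sub_bessel_integrals_le (n : ℕ) {a a' b y : ℝ} (ha : a ^ 2 = π / 12)
    (ha' : a' ^ 2 = π / 48) (hb : b ^ 2 = 2 * π * n - π / 12) (hy : 0 < y) (hy1 : y ≤ 1 / 100) :
    |p n - 2 * (∫ x in (0:ℝ)..1 / 2, besselIntegrand a b y x).re -
      (-1) ^ n * Real.sqrt 2 * (2 * (∫ x in (0:ℝ)..1 / 2, besselIntegrand a' b y x).re)| ≤
      (4 + 101 / 100 * Real.exp (π / (108 * y))) * Real.exp (2 * π * n * y) := by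
  have c1 : Continuous fun x : ℝ ↦ partitionGenFun (y + x * Complex.I) *
      Complex.exp (2 * π * n * (y + x * Complex.I)) :=
    (continuous_partitionGenFun_line hy).mul (by fun_prop)
  have c2 : Continuous (besselIntegrand a b y) := continuous_bessel_integrand a b hy
  have c3 : Continuous fun x : ℝ ↦
      (((-1) ^ n * Real.sqrt 2 : ℝ) : ℂ) * besselIntegrand a' b y (x - 1 / 2) :=
    continuous_const.mul ((continuous_bessel_integrand a' b hy).comp (by fun_prop))
  have hI : (∫ x in (0:ℝ)..1 / 2, (partitionGenFun (y + x * Complex.I) *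
      Complex.exp (2 * π * n * (y + x * Complex.I)) - besselIntegrand a b y x -
      (((-1) ^ n * Real.sqrt 2 : ℝ) : ℂ) * besselIntegrand a' b y (x - 1 / 2))).re =
      (∫ x in (0:ℝ)..1 / 2, partitionGenFun (y + x * Complex.I) *
        Complex.exp (2 * π * n * (y + x * Complex.I))).re -
      (∫ x in (0:ℝ)..1 / 2, besselIntegrand a b y x).re -
      (-1) ^ n * Real.sqrt 2 * (∫ x in (0:ℝ)..1 / 2, besselIntegrand a' b y x).re := by
    have c12 : Continuous fun x : ℝ ↦ partitionGenFun (y + x * Complex.I) *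
      Complex.exp (2 * π * n * (y + x * Complex.I)) - besselIntegrand a b y x := c1.sub c2
    rw [intervalIntegral.integral_sub (c12.intervalIntegrable _ _)
      (c3.intervalIntegrable _ _), intervalIntegral.integral_sub (c1.intervalIntegrable _ _)
      (c2.intervalIntegrable _ _), intervalIntegral.integral_const_mul, Complex.sub_re,
      Complex.sub_re, Complex.re_ofReal_mul, re_integral_besselIntegrand_shift a' b hy]
  have hle := intervalIntegral.norm_integral_le_of_norm_le_const (a := 0) (b := 1 / 2)
    (f := fun x : ℝ ↦ partitionGenFun (y + x * Complex.I) *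
      Complex.exp (2 * π * n * (y + x * Complex.I)) - besselIntegrand a b y x -
      (((-1) ^ n * Real.sqrt 2 : ℝ) : ℂ) * besselIntegrand a' b y (x - 1 / 2))
    (C := (4 + 101 / 100 * Real.exp (π / (108 * y))) * Real.exp (2 * π * n * y))
    (fun x hx ↦ by
      rw [Set.uIoc_of_le (by norm_num)] at hx
      rw [← cuspZeroTerm_mul_exp ha hb, ← cuspHalfTerm_mul_exp ha' hb, ← sub_mul, ← sub_mul,
        norm_mul, Complex.norm_exp]
      have e : (2 * π * n * (y + x * Complex.I) : ℂ).re = 2 * π * n * y := by simp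
      rw [e]
      gcongr
      exact norm_partitionGenFun_sub_cuspTerms_le hy hy1 hx.1.le hx.2)
  have h2 := (Complex.abs_re_le_norm _).trans hle
  rw [hI, sub_zero, abs_of_pos (by norm_num : (0:ℝ) < 1 / 2)] at h2
  have h3 := p_eq_integral n hy
  rw [abs_le] at h2 ⊢
  constructor <;> linarith [h2.1, h2.2]

/-- The argument of the exponential in the Hardy–Ramanujan approximation of `p n`. -/
noncomputable def partitionExponent (n : ℕ) : ℝ := π * Real.sqrt (24 * n - 1) / 6

/-- The leading term of the Hardy–Ramanujan–Rademacher expansion of `p n`. -/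
noncomputable def partitionMainTerm (n : ℕ) : ℝ :=
  Real.sqrt 12 / (24 * n - 1) * (1 - 1 / partitionExponent n) * Real.exp (partitionExponent n)

lemma forty_mul_le_exp {n : ℕ} (hn : 600 ≤ n) :
    40 * (n : ℝ) ≤ Real.exp (π * Real.sqrt (6 * n) / 18) := by
  have hn' : (600 : ℝ) ≤ n := by exact_mod_cast hn
  have hpi := Real.pi_gt_d2
  have hpi2 := Real.pi_lt_d2
  have hr : 60 ≤ Real.sqrt (6 * n) := Real.le_sqrt_of_sq_le (by linarith)
  have hr2 : Real.sqrt (6 * n) ^ 2 = 6 * n := Real.sq_sqrt (by linarith)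
  set L := π * Real.sqrt (6 * n) / 18 with hL
  have hL1 : 10.4 ≤ L := by
    rw [hL]
    nlinarith
  have hLn : 40 * (n : ℝ) ≤ 220 * L ^ 2 := by
    rw [hL, div_pow, mul_pow, hr2]
    have : (9.85 : ℝ) ≤ π ^ 2 := by nlinarith
    nlinarith
  have he10 : (22000 : ℝ) ≤ Real.exp 10 := by
    have h1 := Real.exp_one_gt_d9
    have h2 : Real.exp 10 = Real.exp 1 ^ 10 := by rw [← Real.exp_nat_mul]; norm_num
    rw [h2]
    calc (22000 : ℝ) ≤ 2.718 ^ 10 := by norm_num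
      _ ≤ _ := by gcongr; linarith
  have he4 : (1.4 : ℝ) ≤ Real.exp 0.4 := by
    have := Real.add_one_le_exp (0.4 : ℝ); linarith
  have he : (30800 : ℝ) ≤ Real.exp 10.4 := by
    rw [show (10.4 : ℝ) = 10 + 0.4 by norm_num, Real.exp_add]
    nlinarith
  have hd : ((L - 10.4) / 2 + 1) ^ 2 ≤ Real.exp (L - 10.4) := by
    rw [show L - 10.4 = (L - 10.4) / 2 + (L - 10.4) / 2 by ring, Real.exp_add, ← pow_two]
    refine pow_le_pow_left₀ (by linarith) ?_ 2
    have := Real.add_one_le_exp ((L - 10.4) / 2)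
    linarith
  have hfin : Real.exp L = Real.exp 10.4 * Real.exp (L - 10.4) := by
    rw [← Real.exp_add]; congr 1; ring
  rw [hfin]
  refine hLn.trans ?_
  calc 220 * L ^ 2 ≤ 30800 * ((L - 10.4) / 2 + 1) ^ 2 := by nlinarith
    _ ≤ _ := by gcongr

lemma exp_mul_le_exp_partitionExponent {n : ℕ} (hn : 600 ≤ n) :
    0.998 * Real.exp (π * Real.sqrt (6 * n) / 18) ^ 3 ≤ Real.exp (partitionExponent n / 2) := by
  have hn' : (600 : ℝ) ≤ n := by exact_mod_cast hn
  have hpi2 := Real.pi_lt_d2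
  have e6 : Real.sqrt (24 * n) = 2 * Real.sqrt (6 * n) := by
    rw [show (24 * n : ℝ) = 2 ^ 2 * (6 * n) by ring, Real.sqrt_mul (by norm_num),
      Real.sqrt_sq (by norm_num)]
  have h1 : 100 ≤ Real.sqrt (24 * n) := Real.le_sqrt_of_sq_le (by linarith)
  have h2 : 100 ≤ Real.sqrt (24 * n - 1) := Real.le_sqrt_of_sq_le (by linarith)
  have s1 : Real.sqrt (24 * n) ^ 2 = 24 * n := Real.sq_sqrt (by linarith)
  have s2 : Real.sqrt (24 * n - 1) ^ 2 = 24 * n - 1 := Real.sq_sqrt (by linarith)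
  have hd : Real.sqrt (24 * n) - 0.005 ≤ Real.sqrt (24 * n - 1) := by nlinarith
  have hexp : 3 * (π * Real.sqrt (6 * n) / 18) - 0.002 ≤ partitionExponent n / 2 := by
    rw [partitionExponent]
    have : Real.sqrt (6 * n) = Real.sqrt (24 * n) / 2 := by rw [e6]; ring
    rw [this]
    nlinarith [Real.pi_pos]
  calc 0.998 * Real.exp (π * Real.sqrt (6 * n) / 18) ^ 3
      ≤ Real.exp (-0.002) * Real.exp (3 * (π * Real.sqrt (6 * n) / 18)) := by
        rw [← Real.exp_nat_mul]
        gcongr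
        · have := Real.add_one_le_exp (-0.002 : ℝ); linarith
        · norm_num
    _ = Real.exp (3 * (π * Real.sqrt (6 * n) / 18) - 0.002) := by
        rw [← Real.exp_add]; congr 1; ring
    _ ≤ _ := Real.exp_le_exp.2 hexp

lemma abs_sub_lt_of_bessel_bounds {n : ℕ} (hn : 600 ≤ n) {q b κ μ X J1 J2 : ℝ} (hκ9 : 0.9 ≤ κ)
    (hμ2 : 2 ≤ μ) (hb0 : 0 < b) (hbn : 2 * b ^ 2 ≤ 4 * π * n) (hbn' : b ≤ n)
    (hXn : 40 * (n : ℝ) ≤ X) (hX3 : 0.998 * X ^ 3 ≤ Real.exp (μ / 2))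
    (hP : |q - 2 * J1 - (-1) ^ n * Real.sqrt 2 * (2 * J2)| ≤ (4 + 101 / 100 * X) * X)
    (hB1' : |b ^ 2 * (2 * J1) - κ * (1 - 1 / μ) * Real.exp μ| ≤ (3 * b + 8) * (2 * X))
    (hB2' : |b ^ 2 * (2 * J2) - κ * (1 / 2 - 1 / μ) * Real.exp (μ / 2)| ≤
      (3 * b + 8) * (2 * X)) :
    |b ^ 2 * q - κ * (1 - 1 / μ) * Real.exp μ| < κ * (1 - 1 / (24 * n)) * Real.exp (μ / 2) := by
  have hn' : (600 : ℝ) ≤ n := by exact_mod_cast hn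
  have hpi4 := Real.pi_lt_d4
  have hX0 : 0 < X := by linarith
  have h2pos : 0 < Real.sqrt 2 := by positivity
  have h2 : Real.sqrt 2 ≤ 1.4144 := Real.sqrt_le_iff.2 (by norm_num)
  have hκ0 : 0 < κ := by linarith
  have hm1 : 1 / μ ≤ 1 / 2 := one_div_le_one_div_of_le (by norm_num) hμ2
  have hm0 : 0 < 1 / μ := by positivity
  have hX := Real.exp_pos (μ / 2)
  have hB2'' : |b ^ 2 * (2 * J2)| ≤ κ / 2 * Real.exp (μ / 2) + (3 * b + 8) * (2 * X) := by
    have : |κ * (1 / 2 - 1 / μ) * Real.exp (μ / 2)| ≤ κ / 2 * Real.exp (μ / 2) := by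
      rw [abs_of_nonneg (mul_nonneg (mul_nonneg hκ0.le (by linarith)) hX.le)]
      gcongr
      nlinarith
    have h := abs_add_le (b ^ 2 * (2 * J2) - κ * (1 / 2 - 1 / μ) * Real.exp (μ / 2))
      (κ * (1 / 2 - 1 / μ) * Real.exp (μ / 2))
    rw [sub_add_cancel] at h
    linarith
  have hbpos : 0 < b ^ 2 := by positivity
  have hsplit : b ^ 2 * q - κ * (1 - 1 / μ) * Real.exp μ =
      b ^ 2 * (q - 2 * J1 - (-1) ^ n * Real.sqrt 2 * (2 * J2)) +
      (b ^ 2 * (2 * J1) - κ * (1 - 1 / μ) * Real.exp μ) +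
      (-1) ^ n * Real.sqrt 2 * (b ^ 2 * (2 * J2)) := by ring
  rw [hsplit]
  have hthird : |(-1) ^ n * Real.sqrt 2 * (b ^ 2 * (2 * J2))| ≤
      1.4144 * (κ / 2 * Real.exp (μ / 2) + (3 * b + 8) * (2 * X)) := by
    rw [abs_mul, abs_mul, abs_pow, abs_neg, abs_one, one_pow, one_mul, abs_of_pos h2pos]
    gcongr
  have hfirst : |b ^ 2 * (q - 2 * J1 - (-1) ^ n * Real.sqrt 2 * (2 * J2))| ≤
      6.2832 * n * ((4 + 101 / 100 * X) * X) := by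
    rw [abs_mul, abs_of_pos hbpos]
    gcongr
    nlinarith
  refine (abs_add_three _ _ _).trans_lt ?_
  have hgap : 0.29 * κ * Real.exp (μ / 2) ≤
      κ * (1 - 1 / (24 * n)) * Real.exp (μ / 2) - 1.4144 * (κ / 2 * Real.exp (μ / 2)) := by
    have : 1 / (24 * (n : ℝ)) ≤ 1 / 14400 := one_div_le_one_div_of_le (by norm_num) (by linarith)
    have h0 : 0 < κ * Real.exp (μ / 2) := by positivity
    nlinarith
  have hgap2 : 0.26 * X ^ 3 ≤ 0.29 * κ * Real.exp (μ / 2) := by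
    calc 0.26 * X ^ 3 ≤ 0.29 * 0.9 * (0.998 * X ^ 3) := by
          nlinarith [pow_pos hX0 3]
      _ ≤ _ := by gcongr
  have hmainineq : 6.2832 * n * ((4 + 101 / 100 * X) * X) + 2.4144 * ((3 * b + 8) * (2 * X)) <
      0.26 * X ^ 3 := by
    have hX24 : 24000 ≤ X := by linarith
    have h3 : 2.4144 * ((3 * b + 8) * (2 * X)) ≤ 2.4144 * ((6 * n + 8) * (2 * X)) := by
      gcongr; linarith
    have h4 : 6.2832 * n * ((4 + 101 / 100 * X) * X) + 2.4144 * ((6 * n + 8) * (2 * X)) ≤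
        (7 * n) * X * X := by
      nlinarith [mul_pos hX0 (show (0:ℝ) < n by linarith)]
    have h5 : (7 * (n : ℝ)) * X * X < 0.26 * X ^ 3 := by
      have : 7 * (n : ℝ) < 0.26 * X := by linarith
      calc (7 * (n : ℝ)) * X * X < 0.26 * X * X * X := by gcongr
        _ = _ := by ring
    linarith
  linarith

lemma abs_p_sub_partitionMainTerm_lt_of_large {n : ℕ} (hn : 600 ≤ n) :
    |p n - partitionMainTerm n| <
      Real.exp (partitionExponent n / 2) / (4 * Real.sqrt 3 * n) := by
  have hn' : (600 : ℝ) ≤ n := by exact_mod_cast hn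
  have hpi := Real.pi_gt_d2
  have hpi2 := Real.pi_lt_d2
  have hpi4 := Real.pi_lt_d4
  set r := Real.sqrt (6 * n) with hr
  have hr60 : 60 ≤ r := Real.le_sqrt_of_sq_le (by linarith)
  have hr2 : r ^ 2 = 6 * n := Real.sq_sqrt (by linarith)
  set y := 1 / (6 * r) with hy
  have hy0 : 0 < y := by positivity
  have hy1 : y ≤ 1 / 100 := one_div_le_one_div_of_le (by norm_num) (by linarith)
  set L := π * r / 18 with hL
  have hLy : π / (108 * y) = L := by rw [hy, hL]; field_simp; norm_num
  have hLn : 2 * π * n * y = L := by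
    rw [hy, hL]; field_simp; linarith
  set a := Real.sqrt (π / 12) with ha
  have ha2 : a ^ 2 = π / 12 := Real.sq_sqrt (by positivity)
  have ha0 : 0 < a := Real.sqrt_pos.2 (by positivity)
  have ha1 : a ≤ 13 / 25 := Real.sqrt_le_iff.2 ⟨by norm_num, by linarith⟩
  set b := Real.sqrt (2 * π * n - π / 12) with hb
  have ht0 : 100 ≤ 2 * π * n - π / 12 := by nlinarith
  have hb2 : b ^ 2 = 2 * π * n - π / 12 := Real.sq_sqrt (by linarith)
  have hb10 : 10 ≤ b := Real.le_sqrt_of_sq_le (by linarith)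
  have hbr : b ≤ 2 * r := Real.sqrt_le_iff.2 ⟨by linarith, by nlinarith⟩
  have hrn : 2 * r ≤ n := by nlinarith
  have hspi : Real.sqrt π ^ 2 = π := Real.sq_sqrt Real.pi_pos.le
  have h12 : Real.sqrt 12 ^ 2 = 12 := Real.sq_sqrt (by norm_num)
  have h12pos : 0 < Real.sqrt 12 := by positivity
  set κ := π / Real.sqrt 12 with hκ
  have hκa : Real.sqrt π * a = κ := by
    rw [ha, hκ, ← Real.sqrt_mul Real.pi_pos.le, show π * (π / 12) = π ^ 2 / 12 by ring,
      Real.sqrt_div (by positivity), Real.sqrt_sq Real.pi_pos.le]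
  set μ := partitionExponent n with hμ
  have hab : 2 * a * b = μ := by
    rw [hμ, partitionExponent, ha, hb, mul_assoc, ← Real.sqrt_mul (by positivity),
      show π / 12 * (2 * π * n - π / 12) = (π / 12) ^ 2 * (24 * n - 1) by ring,
      Real.sqrt_mul (by positivity), Real.sqrt_sq (by positivity)]
    ring
  have hμ2 : 2 ≤ μ := by
    rw [hμ, partitionExponent]
    have : 100 ≤ Real.sqrt (24 * n - 1) := Real.le_sqrt_of_sq_le (by linarith)
    nlinarith
  have hκb : Real.sqrt π * (1 / (2 * b)) = κ / μ := by
    rw [← hab, ← hκa]; field_simp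
  have hB1 := integral_bessel ha0 ha1 hb10 hy0 hy1
  have hB2 := integral_bessel (a := a / 2) (by positivity) (by linarith) hb10 hy0 hy1
  have hP := abs_p_sub_bessel_integrals_le n (a' := a / 2) ha2 (by rw [div_pow, ha2]; ring) hb2
    hy0 hy1
  change |b ^ 2 * (2 * (∫ x in (0:ℝ)..1 / 2, besselIntegrand a b y x).re) - _| ≤ _ at hB1
  change |b ^ 2 * (2 * (∫ x in (0:ℝ)..1 / 2, besselIntegrand (a / 2) b y x).re) - _| ≤ _ at hB2
  generalize (∫ x in (0:ℝ)..1 / 2, besselIntegrand a b y x).re = J1 at hB1 hP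
  generalize (∫ x in (0:ℝ)..1 / 2, besselIntegrand (a / 2) b y x).re = J2 at hB2 hP
  rw [hLy, hLn] at hP
  have hX0 := Real.exp_pos L
  have hXn : 40 * (n : ℝ) ≤ Real.exp L := forty_mul_le_exp hn
  have hX3 : 0.998 * Real.exp L ^ 3 ≤ Real.exp (μ / 2) := exp_mul_le_exp_partitionExponent hn
  have hee : Real.exp (b ^ 2 * y + 4 * a ^ 2 * y) ≤ 2 * Real.exp L := by
    have e : b ^ 2 * y + 4 * a ^ 2 * y = π / 4 * y + L := by
      rw [ha2, hb2, ← hLn]; ring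
    rw [e, Real.exp_add]
    gcongr
    have hs : π / 4 * y ≤ Real.log 2 := by
      have := Real.log_two_gt_d9
      calc π / 4 * y ≤ 3.15 / 4 * (1 / 100) := by gcongr
        _ ≤ _ := by linarith
    calc Real.exp (π / 4 * y) ≤ Real.exp (Real.log 2) := Real.exp_le_exp.2 hs
      _ = 2 := Real.exp_log (by norm_num)
  have hee' : Real.exp (b ^ 2 * y + 4 * (a / 2) ^ 2 * y) ≤ 2 * Real.exp L := by
    refine le_trans (Real.exp_le_exp.2 ?_) hee
    have := mul_pos (pow_pos ha0 2) hy0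
    linarith
  have hB1' : |b ^ 2 * (2 * J1) - κ * (1 - 1 / μ) * Real.exp μ| ≤
      (3 * b + 8) * (2 * Real.exp L) := by
    have e : Real.sqrt π * (a - 1 / (2 * b)) * Real.exp (2 * a * b) =
        κ * (1 - 1 / μ) * Real.exp μ := by
      rw [mul_sub, hκa, hκb, hab]; ring
    rw [e] at hB1
    refine hB1.trans ?_
    gcongr
  have hB2' : |b ^ 2 * (2 * J2) - κ * (1 / 2 - 1 / μ) * Real.exp (μ / 2)| ≤
      (3 * b + 8) * (2 * Real.exp L) := by
    have e : Real.sqrt π * (a / 2 - 1 / (2 * b)) * Real.exp (2 * (a / 2) * b) =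
        κ * (1 / 2 - 1 / μ) * Real.exp (μ / 2) := by
      rw [mul_sub, mul_div_assoc', hκa, hκb, ← hab]; ring_nf
    rw [e] at hB2
    refine hB2.trans ?_
    gcongr
  have hκ9 : 0.9 ≤ κ := by
    rw [hκ, le_div_iff₀ h12pos]
    have : Real.sqrt 12 ≤ 3.47 := Real.sqrt_le_iff.2 (by norm_num)
    linarith
  have htmain : b ^ 2 * partitionMainTerm n = κ * (1 - 1 / μ) * Real.exp μ := by
    rw [partitionMainTerm, ← hμ, hb2, hκ]
    have h24 : (24 * (n : ℝ) - 1) ≠ 0 := by linarith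
    have e : (2 * π * n - π / 12) * (Real.sqrt 12 / (24 * n - 1)) = π / Real.sqrt 12 := by
      rw [show 2 * π * n - π / 12 = π / 12 * (24 * n - 1) by ring,
        mul_assoc, mul_div_cancel₀ _ h24, div_mul_eq_mul_div, div_eq_div_iff (by norm_num)
        h12pos.ne', mul_assoc, ← pow_two, h12]
    rw [← e]; ring
  have hbpos : 0 < b ^ 2 := by positivity
  have htarget : b ^ 2 * (Real.exp (μ / 2) / (4 * Real.sqrt 3 * n)) =
      κ * (1 - 1 / (24 * n)) * Real.exp (μ / 2) := by
    have e12 : Real.sqrt 12 = 2 * Real.sqrt 3 := by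
      rw [show (12 : ℝ) = 2 ^ 2 * 3 by norm_num, Real.sqrt_mul (by norm_num),
        Real.sqrt_sq (by norm_num)]
    have : (n : ℝ) ≠ 0 := by linarith
    rw [hb2, hκ, e12]
    field_simp
    ring
  rw [← mul_lt_mul_iff_right₀ hbpos, htarget]
  nth_rewrite 1 [← abs_of_pos hbpos]
  rw [← abs_mul, mul_sub, htmain]
  exact abs_sub_lt_of_bessel_bounds hn hκ9 hμ2 (by linarith) (by rw [hb2]; linarith)
    (hbr.trans hrn)    hXn hX3 hP hB1' hB2'

lemma ringChoose_neg_half (k : ℕ) :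
    Ring.choose (-1 / 2 : ℝ) k * (-4) ^ k = (Nat.centralBinom k : ℝ) := by
  have h : ∀ k : ℕ, ((k : ℝ) + 1) * Ring.choose (-1 / 2 : ℝ) (k + 1) =
      Ring.choose (-1 / 2 : ℝ) k * (-1 / 2 - k) := by
    intro k
    have h1 := Ring.descPochhammer_eq_factorial_smul_choose (-1 / 2 : ℝ) (k + 1)
    have h2 := Ring.descPochhammer_eq_factorial_smul_choose (-1 / 2 : ℝ) k
    rw [descPochhammer_succ_right, Polynomial.smeval_mul, h2, Nat.factorial_succ] at h1
    have hf : (k.factorial : ℝ) ≠ 0 := by positivity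
    simp only [Polynomial.smeval_sub, Polynomial.smeval_X, Polynomial.smeval_natCast, pow_one,
      pow_zero, nsmul_eq_mul, mul_one] at h1
    apply mul_left_cancel₀ hf
    push_cast at h1
    linarith
  induction k with
  | zero => simp
  | succ k ih =>
    have hk : (k : ℝ) + 1 ≠ 0 := by positivity
    have hc : ((k : ℝ) + 1) * (Nat.centralBinom (k + 1) : ℝ) =
        2 * (2 * k + 1) * (Nat.centralBinom k : ℝ) := by
      exact_mod_cast Nat.succ_mul_centralBinom_succ k
    apply mul_left_cancel₀ hk
    rw [hc, ← ih, pow_succ]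
    linear_combination (-4) ^ k * (-4) * h k

lemma hasSum_centralBinom {s : ℝ} (hs0 : 0 < s) (hs : s < 1 / 4) :
    HasSum (fun k ↦ (Nat.centralBinom k : ℝ) * s ^ k) (1 / Real.sqrt (1 - 4 * s)) := by
  have h := (Real.one_add_rpow_hasFPowerSeriesOnBall_zero (a := -1 / 2)).hasSum
    (y := -4 * s) (by
      rw [Metric.mem_eball, edist_zero_right, ← ofReal_norm, ENNReal.ofReal_lt_one,
        Real.norm_eq_abs, abs_lt]
      constructor <;> linarith)
  simp only [binomialSeries_apply, List.ofFn_const, List.prod_replicate, smul_eq_mul, zero_add] at h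
  have e : (1 + -4 * s) ^ (-1 / 2 : ℝ) = 1 / Real.sqrt (1 - 4 * s) := by
    rw [show (-1 / 2 : ℝ) = -(1 / 2) by norm_num, Real.rpow_neg (by linarith), ← Real.sqrt_eq_rpow,
      one_div]
    ring_nf
  rw [e] at h
  refine h.congr_fun ?_
  intro k
  rw [← ringChoose_neg_half, mul_pow, mul_assoc]

lemma hasSum_of_hasSum_succ {f : ℕ → ℝ} {a : ℝ} (h : HasSum f a) :
    HasSum (fun k ↦ f (k + 1)) (a - f 0) := by
  simpa using (hasSum_nat_add_iff' 1).2 h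

lemma two_mul_choose_eq (k : ℕ) :
    ((2 * (k + 1)).choose (k + 1) : ℝ) = 2 * ((2 * k + 1).choose k : ℝ) := by
  have h : (2 * (k + 1)).choose (k + 1) = (2 * k + 1).choose k + (2 * k + 1).choose (k + 1) :=
    Nat.choose_succ_succ (2 * k + 1) k
  have h2 : (2 * k + 1).choose (k + 1) = (2 * k + 1).choose k :=
    Nat.choose_symm_of_eq_add (by omega)
  rw [h, h2]
  push_cast
  ring

lemma choose_two_mul_add_sub (j k : ℕ) :
    ((2 * k + (j + 2)).choose k : ℝ) = ((2 * (k + 1) + (j + 1)).choose (k + 1) : ℝ) -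
      ((2 * (k + 1) + j).choose (k + 1) : ℝ) := by
  rw [show 2 * (k + 1) + (j + 1) = (2 * k + (j + 2)) + 1 by ring, Nat.choose_succ_succ,
    show 2 * (k + 1) + j = 2 * k + (j + 2) by ring]
  push_cast
  ring

lemma hasSum_choose {s r B : ℝ} (hs0 : 0 < s) (hr0 : 0 < r) (hr : r ^ 2 = 1 - 4 * s)
    (hB : 2 * s * B = 1 - r) (j : ℕ) :
    HasSum (fun k ↦ ((2 * k + j).choose k : ℝ) * s ^ k) (B ^ j / r) := by
  have hBB : s * B ^ 2 = B - 1 := by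
    have : (2 * s) ^ 2 * B ^ 2 = 2 * (2 * s * B) - 4 * s := by
      rw [← mul_pow, hB]; linear_combination hr
    have h4 : 4 * s ≠ 0 := by positivity
    apply mul_left_cancel₀ h4
    linear_combination this
  have h0 : HasSum (fun k ↦ ((2 * k + 0).choose k : ℝ) * s ^ k) (B ^ 0 / r) := by
    have := hasSum_centralBinom hs0 (by nlinarith)
    rw [← hr, Real.sqrt_sq hr0.le] at this
    simpa [Nat.centralBinom] using this
  have h1 : HasSum (fun k ↦ ((2 * k + 1).choose k : ℝ) * s ^ k) (B ^ 1 / r) := by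
    have h := (hasSum_of_hasSum_succ h0).mul_left (1 / (2 * s))
    have e : 1 / (2 * s) * (B ^ 0 / r - ((2 * 0 + 0).choose 0 : ℝ) * s ^ 0) = B ^ 1 / r := by
      simp
      field_simp
      linarith
    rw [e] at h
    refine h.congr_fun fun k ↦ ?_
    have := two_mul_choose_eq k
    rw [add_zero, this]
    field_simp
    ring
  induction j using Nat.twoStepInduction with
  | zero => exact h0
  | one => exact h1
  | more j ih0 ih1 =>
    have h := ((hasSum_of_hasSum_succ ih1).sub (hasSum_of_hasSum_succ ih0)).mul_left (1 / s)
    have e : 1 / s * (B ^ (j + 1) / r - ((2 * 0 + (j + 1)).choose 0 : ℝ) * s ^ 0 -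
        (B ^ j / r - ((2 * 0 + j).choose 0 : ℝ) * s ^ 0)) = B ^ (j + 2) / r := by
      simp only [Nat.choose_zero_right]
      field_simp
      linear_combination -B ^ j * hBB
    rw [e] at h
    refine h.congr_fun fun k ↦ ?_
    rw [choose_two_mul_add_sub]
    field_simp
    ring

lemma hasSum_mul_choose {s r B : ℝ} (hs0 : 0 < s) (hr0 : 0 < r) (hr : r ^ 2 = 1 - 4 * s)
    (hB : 2 * s * B = 1 - r) (j : ℕ) :
    HasSum (fun k : ℕ ↦ (k : ℝ) * ((2 * k + j).choose k : ℝ) * s ^ k)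
      (j * s * B ^ (j + 1) / r ^ 2 + 2 * s * B ^ j / r ^ 3) := by
  have hBB : s * B ^ 2 = B - 1 := by
    have : (2 * s) ^ 2 * B ^ 2 = 2 * (2 * s * B) - 4 * s := by
      rw [← mul_pow, hB]; linear_combination hr
    have h4 : 4 * s ≠ 0 := by positivity
    apply mul_left_cancel₀ h4
    linear_combination this
  have hF := hasSum_choose hs0 hr0 hr hB
  have hsum : Summable fun k : ℕ ↦ (k : ℝ) * ((2 * k + 0).choose k : ℝ) * s ^ k := by
    have h4 : ‖4 * s‖ < 1 := by
      rw [Real.norm_of_nonneg (by linarith)]; nlinarith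
    refine (summable_pow_mul_geometric_of_norm_lt_one 1 h4).of_nonneg_of_le
      (fun k ↦ by positivity) fun k ↦ ?_
    rw [pow_one, mul_pow, ← mul_assoc]
    gcongr
    have := Nat.centralBinom_le_four_pow k
    rw [Nat.centralBinom] at this
    exact_mod_cast this
  obtain ⟨d, hd⟩ := hsum
  have h1' : HasSum (fun k : ℕ ↦ (k : ℝ) * ((2 * k + 1).choose k : ℝ) * s ^ k)
      (d / (2 * s) - B ^ 1 / r) := by
    have h := ((hasSum_of_hasSum_succ hd).mul_left (1 / (2 * s))).sub (hF 1)
    have e : 1 / (2 * s) * (d - ((0 : ℕ) : ℝ) * ((2 * 0 + 0).choose 0 : ℝ) * s ^ 0) - B ^ 1 / r =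
        d / (2 * s) - B ^ 1 / r := by
      simp; ring
    rw [e] at h
    refine h.congr_fun fun k ↦ ?_
    have := two_mul_choose_eq k
    rw [add_zero, this]
    push_cast
    field_simp
    ring
  have hdval : d = 2 * s / r ^ 3 := by
    have h := ((hd.mul_left 2).add (hF 0)).mul_left (2 * s)
    have h' := hasSum_of_hasSum_succ hd
    have hu := h'.unique (h.congr_fun fun k ↦ by
      have : ((k : ℝ) + 1) * (Nat.centralBinom (k + 1) : ℝ) =
          2 * (2 * k + 1) * (Nat.centralBinom k : ℝ) := by
        exact_mod_cast Nat.succ_mul_centralBinom_succ k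
      rw [Nat.centralBinom, Nat.centralBinom] at this
      simp only [add_zero]
      push_cast
      rw [this]; ring)
    simp at hu
    field_simp at hu ⊢
    have : d * r ^ 2 * r = 2 * s := by
      rw [hr]; linear_combination hu
    linear_combination this
  have h0 : HasSum (fun k : ℕ ↦ (k : ℝ) * ((2 * k + 0).choose k : ℝ) * s ^ k)
      ((0 : ℕ) * s * B ^ (0 + 1) / r ^ 2 + 2 * s * B ^ 0 / r ^ 3) := by
    simpa [← hdval] using hd
  have h1 : HasSum (fun k : ℕ ↦ (k : ℝ) * ((2 * k + 1).choose k : ℝ) * s ^ k)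
      ((1 : ℕ) * s * B ^ (1 + 1) / r ^ 2 + 2 * s * B ^ 1 / r ^ 3) := by
    convert h1' using 1
    rw [hdval]
    have : r = 1 - 2 * s * B := by linarith
    field_simp
    rw [this]
    push_cast
    linear_combination (-1 + 2 * s * B) * hBB
  induction j using Nat.twoStepInduction with
  | zero => exact h0
  | one => exact h1
  | more j ih0 ih1 =>
    have h := (((hasSum_of_hasSum_succ ih1).sub (hasSum_of_hasSum_succ ih0)).mul_left (1 / s)).sub
      (hF (j + 2))
    have hr' : r = 1 - 2 * s * B := by linarith
    have e : 1 / s * (((j + 1 : ℕ) : ℝ) * s * B ^ (j + 1 + 1) / r ^ 2 +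
        2 * s * B ^ (j + 1) / r ^ 3 - ((0 : ℕ) : ℝ) * ((2 * 0 + (j + 1)).choose 0 : ℝ) * s ^ 0 -
        (j * s * B ^ (j + 1) / r ^ 2 + 2 * s * B ^ j / r ^ 3 -
          ((0 : ℕ) : ℝ) * ((2 * 0 + j).choose 0 : ℝ) * s ^ 0)) - B ^ (j + 2) / r =
        ((j + 2 : ℕ) : ℝ) * s * B ^ (j + 2 + 1) / r ^ 2 + 2 * s * B ^ (j + 2) / r ^ 3 := by
      simp only [Nat.cast_zero, zero_mul, sub_zero]
      push_cast
      field_simp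
      linear_combination -B ^ j * (((j + 2) * B * r + 2) * hBB + r * (B ^ 2 * hr' - 2 * B * hBB))
    rw [e] at h
    refine h.congr_fun fun k ↦ ?_
    rw [choose_two_mul_add_sub]
    push_cast
    field_simp
    ring

lemma hasSum_pow_div_factorial_mul_affine (z α β : ℝ) :
    HasSum (fun j : ℕ ↦ z ^ j / (j.factorial : ℝ) * (j * α + β)) (Real.exp z * (z * α + β)) := by
  have h0 : HasSum (fun j : ℕ ↦ z ^ j / (j.factorial : ℝ)) (Real.exp z) := by
    rw [Real.exp_eq_exp_ℝ]
    exact NormedSpace.exp_series_hasSum_exp' (𝔸 := ℝ) z |>.congr_fun fun j ↦ by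
      rw [smul_eq_mul]; ring
  have h1 : HasSum (fun j : ℕ ↦ z ^ j / (j.factorial : ℝ) * j) (z * Real.exp z) := by
    rw [← hasSum_nat_add_iff' 1]
    simp only [Finset.sum_range_one, Nat.cast_zero, mul_zero, sub_zero]
    refine (h0.mul_left z).congr_fun fun j ↦ ?_
    rw [Nat.factorial_succ]
    push_cast
    field_simp
    ring
  have h := (h1.mul_right α).add (h0.mul_right β)
  rw [show z * Real.exp z * α + Real.exp z * β = Real.exp z * (z * α + β) by ring] at h
  exact h.congr_fun fun j ↦ by ring

lemma hasSum_fiber {s r B : ℝ} (hs0 : 0 < s) (hr0 : 0 < r) (hr : r ^ 2 = 1 - 4 * s)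
    (hB : 2 * s * B = 1 - r) (u : ℝ) (j : ℕ) :
    HasSum (fun k : ℕ ↦ ((j + k : ℕ) : ℝ) * ((2 * k + j).choose k : ℝ) * s ^ k *
        (u ^ j / (j.factorial : ℝ)))
      ((u * B) ^ j / (j.factorial : ℝ) * (j * (1 / r + s * B / r ^ 2) + 2 * s / r ^ 3)) := by
  have h := (((hasSum_choose hs0 hr0 hr hB j).mul_left (j : ℝ)).add
    (hasSum_mul_choose hs0 hr0 hr hB j)).mul_right (u ^ j / (j.factorial : ℝ))
  have e : (j * (B ^ j / r) + (j * s * B ^ (j + 1) / r ^ 2 + 2 * s * B ^ j / r ^ 3)) *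
      (u ^ j / (j.factorial : ℝ)) =
      (u * B) ^ j / (j.factorial : ℝ) * (j * (1 / r + s * B / r ^ 2) + 2 * s / r ^ 3) := by
    rw [mul_pow]
    ring
  rw [e] at h
  exact h.congr_fun fun k ↦ by push_cast; ring

lemma hasSum_double {s r B : ℝ} (hs0 : 0 < s) (hr0 : 0 < r) (hr : r ^ 2 = 1 - 4 * s)
    (hB : 2 * s * B = 1 - r) (u : ℝ) :
    HasSum (fun x : ℕ × ℕ ↦ ((x.1 + x.2 : ℕ) : ℝ) * ((2 * x.2 + x.1).choose x.2 : ℝ) * s ^ x.2 *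
        (u ^ x.1 / (x.1.factorial : ℝ)))
      (Real.exp (u * B) * (u * B * (1 / r + s * B / r ^ 2) + 2 * s / r ^ 3)) := by
  have hsum : Summable fun x : ℕ × ℕ ↦ ((x.1 + x.2 : ℕ) : ℝ) *
      ((2 * x.2 + x.1).choose x.2 : ℝ) * s ^ x.2 * (u ^ x.1 / (x.1.factorial : ℝ)) := by
    have habs : Summable fun x : ℕ × ℕ ↦ ((x.1 + x.2 : ℕ) : ℝ) *
        ((2 * x.2 + x.1).choose x.2 : ℝ) * s ^ x.2 * (|u| ^ x.1 / (x.1.factorial : ℝ)) := by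
      refine (summable_prod_of_nonneg fun x ↦ by positivity).2
        ⟨fun j ↦ (hasSum_fiber hs0 hr0 hr hB |u| j).summable, ?_⟩
      simp only [fun j ↦ (hasSum_fiber hs0 hr0 hr hB |u| j).tsum_eq]
      exact (hasSum_pow_div_factorial_mul_affine _ _ _).summable
    refine Summable.of_norm (habs.congr fun x ↦ ?_)
    rw [norm_mul, norm_div, norm_pow, Real.norm_eq_abs u, Real.norm_of_nonneg (by positivity),
      Real.norm_of_nonneg (by positivity)]
  have h := hsum.hasSum.prod_fiberwise fun j ↦ hasSum_fiber hs0 hr0 hr hB u j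
  rw [← h.unique (hasSum_pow_div_factorial_mul_affine _ _ _)]
  exact hsum.hasSum

lemma HasSum.sum_fiber_add_two_mul {f : ℕ × ℕ → ℝ} {a : ℝ} (h : HasSum f a) :
    HasSum (fun m ↦ ∑ k ∈ range (m / 2 + 1), f (m - 2 * k, k)) a := by
  refine (h.tsum_fiberwise fun x ↦ x.1 + 2 * x.2).congr_fun fun m ↦ ?_
  have hset : (fun x : ℕ × ℕ ↦ x.1 + 2 * x.2) ⁻¹' {m} =
      ((range (m / 2 + 1)).image fun k ↦ (m - 2 * k, k) : Finset (ℕ × ℕ)) := by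
    ext ⟨j, k⟩
    simp only [Set.mem_preimage, Set.mem_singleton_iff, coe_image, Set.mem_image, mem_coe,
      mem_range, Prod.mk.injEq]
    constructor
    · rintro rfl
      exact ⟨k, by omega, by omega, rfl⟩
    · rintro ⟨k, hk, rfl, rfl⟩
      omega
  rw [hset, Finset.tsum_subtype', sum_image fun k _ l _ hkl ↦ (Prod.mk.inj hkl).2]

/-- The polynomial sums occurring in the coefficients `c m`, so that
`c m = (-1 / (4√6)) ^ m * coeffSum m`. -/
noncomputable def coeffSum (m : ℕ) : ℝ :=
  ∑ k ∈ range ((m + 1) / 2 + 1), ((m + 1).choose k : ℝ) * ((m + 1 - k : ℕ) : ℝ) /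
    ((m + 1 - 2 * k).factorial : ℝ) * (π / 6) ^ ((m : ℤ) - 2 * k)

lemma hasSum_coeffSum {t r B : ℝ} (ht : t ≠ 0) (hr0 : 0 < r) (hr : r ^ 2 = 1 - 4 * t ^ 2)
    (hB : 2 * t ^ 2 * B = 1 - r) :
    HasSum (fun m ↦ coeffSum m * t ^ m)
      (Real.exp (π / 6 * t * B) * (1 / r ^ 2 + 2 * t / (π / 6 * r ^ 3))) := by
  have hs0 : 0 < t ^ 2 := by positivity
  have hA : (π / 6 : ℝ) ≠ 0 := by positivity
  have h := (hasSum_of_hasSum_succ (hasSum_double hs0 hr0 hr hB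
    (π / 6 * t)).sum_fiber_add_two_mul).mul_left (1 / (π / 6 * t))
  have e : Real.exp (π / 6 * t * B) * (π / 6 * t * B * (1 / r + t ^ 2 * B / r ^ 2) +
      2 * t ^ 2 / r ^ 3) = π / 6 * t * (Real.exp (π / 6 * t * B) *
      (1 / r ^ 2 + 2 * t / (π / 6 * r ^ 3))) := by
    have hBB : t ^ 2 * B ^ 2 = B - 1 := by
      have : (2 * t ^ 2) ^ 2 * B ^ 2 = 2 * (2 * t ^ 2 * B) - 4 * t ^ 2 := by
        rw [← mul_pow, hB]; linear_combination hr
      have h4 : 4 * t ^ 2 ≠ 0 := by positivity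
      apply mul_left_cancel₀ h4
      linear_combination this
    have h1 : B * (r + t ^ 2 * B) = 1 := by
      linear_combination B * hB - hBB
    have h2 : π / 6 * t * B * (1 / r + t ^ 2 * B / r ^ 2) = π / 6 * t * (1 / r ^ 2) := by
      field_simp
      linear_combination h1
    rw [h2]
    field_simp
  rw [e] at h
  simp only [Nat.zero_div, zero_add, sum_range_one, Nat.cast_zero, zero_mul, sub_zero,
    mul_zero, tsub_zero, add_zero] at h
  rw [← mul_assoc, one_div_mul_cancel (by positivity), one_mul] at h
  refine h.congr_fun fun m ↦ ?_
  rw [coeffSum, sum_mul, mul_sum]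
  refine sum_congr rfl fun k hk ↦ ?_
  have hk' : 2 * k ≤ m + 1 := by have := mem_range.1 hk; omega
  have hz : (π / 6 : ℝ) ^ ((m : ℤ) - 2 * k) * (π / 6) = (π / 6) ^ (m + 1 - 2 * k) := by
    rw [← zpow_natCast, ← zpow_add_one₀ hA]
    congr 1
    push_cast [hk']
    ring
  have ht' : t ^ (m + 1 - 2 * k) * t ^ (2 * k) = t ^ m * t := by
    rw [← pow_add, ← pow_succ]
    congr 1
    omega
  rw [show m + 1 - 2 * k + k = m + 1 - k by omega, show 2 * k + (m + 1 - 2 * k) = m + 1 by omega,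
    mul_pow, ← hz, ← pow_mul]
  field_simp
  linear_combination -(((m + 1).choose k : ℝ) * ((m + 1 - k : ℕ) : ℝ)) * ht'

lemma succ_coeffSum_term_le {m k : ℕ} (hk : 2 * k ≤ m + 1) :
    ((m + 2).choose k : ℝ) * ((m + 2 - k : ℕ) : ℝ) / ((m + 2 - 2 * k).factorial : ℝ) *
      (π / 6) ^ (((m + 1 : ℕ) : ℤ) - 2 * k) ≤
    4 * (π / 6) * (((m + 1).choose k : ℝ) * ((m + 1 - k : ℕ) : ℝ) /
      ((m + 1 - 2 * k).factorial : ℝ) * (π / 6) ^ ((m : ℤ) - 2 * k)) := by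
  have hA : (π / 6 : ℝ) ≠ 0 := by positivity
  obtain ⟨j, hj⟩ := Nat.exists_eq_add_of_le hk
  have h1 : ((m + 2).choose k : ℝ) * ((m + 2 - k : ℕ) : ℝ) = (m + 2) * ((m + 1).choose k : ℝ) := by
    have := Nat.choose_mul_succ_eq (m + 1) k
    rw [show m + 1 + 1 = m + 2 by ring] at this
    rw [← Nat.cast_mul, ← this]
    push_cast
    ring
  have h2 : (π / 6 : ℝ) ^ (((m + 1 : ℕ) : ℤ) - 2 * k) =
      π / 6 * (π / 6) ^ ((m : ℤ) - 2 * k) := by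
    rw [mul_comm (π / 6), ← zpow_add_one₀ hA]
    congr 1
    push_cast
    ring
  have h3 : (((m + 2 - 2 * k).factorial : ℕ) : ℝ) =
      (j + 1) * ((m + 1 - 2 * k).factorial : ℝ) := by
    rw [show m + 2 - 2 * k = j + 1 by omega, show m + 1 - 2 * k = j by omega, Nat.factorial_succ]
    push_cast
    ring
  have h4 : ((m : ℝ) + 2) / (j + 1) ≤ 4 * ((m + 1 - k : ℕ) : ℝ) := by
    have : ((m + 2 : ℕ) : ℝ) ≤ ((4 * (m + 1 - k) : ℕ) : ℝ) := by
      exact_mod_cast (by omega : m + 2 ≤ 4 * (m + 1 - k))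
    push_cast at this
    exact (div_le_self (by positivity) (by linarith [j.cast_nonneg (α := ℝ)])).trans this
  rw [h1, h2, h3]
  calc _ = ((m : ℝ) + 2) / (j + 1) * (((m + 1).choose k : ℝ) / ((m + 1 - 2 * k).factorial : ℝ) *
        (π / 6 * (π / 6) ^ ((m : ℤ) - 2 * k))) := by field_simp
    _ ≤ 4 * ((m + 1 - k : ℕ) : ℝ) * (((m + 1).choose k : ℝ) / ((m + 1 - 2 * k).factorial : ℝ) *
        (π / 6 * (π / 6) ^ ((m : ℤ) - 2 * k))) := by gcongr
    _ = _ := by ring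

lemma coeffSum_nonneg (m : ℕ) : 0 ≤ coeffSum m :=
  sum_nonneg fun k _ ↦ by positivity

lemma coeffSum_succ_le (m : ℕ) : coeffSum (m + 1) ≤ 4 * Real.sqrt 6 * coeffSum m := by
  have hsum : ∑ k ∈ range ((m + 1) / 2 + 1), ((m + 2).choose k : ℝ) * ((m + 2 - k : ℕ) : ℝ) /
      ((m + 2 - 2 * k).factorial : ℝ) * (π / 6) ^ (((m + 1 : ℕ) : ℤ) - 2 * k) ≤
      4 * (π / 6) * coeffSum m := by
    rw [coeffSum, mul_sum]
    exact sum_le_sum fun k hk ↦ succ_coeffSum_term_le (by have := mem_range.1 hk; omega)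
  have hextra : coeffSum (m + 1) ≤ 4 * (π / 6) * coeffSum m + 12 / π * coeffSum m := by
    have hpos := mul_nonneg (by positivity : 0 ≤ 12 / π) (coeffSum_nonneg m)
    obtain ⟨q, rfl | rfl⟩ := Nat.even_or_odd' m
    · rw [coeffSum, show (2 * q + 1 + 1) / 2 + 1 = (2 * q + 1) / 2 + 1 + 1 by omega,
        sum_range_succ]
      refine add_le_add hsum ?_
      have hq : (2 * q + 1) / 2 = q := by omega
      have hle : ((2 * q + 1).choose q : ℝ) * ((q : ℝ) + 1) ≤ coeffSum (2 * q) := by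
        have := single_le_sum (f := fun k ↦ ((2 * q + 1).choose k : ℝ) *
          ((2 * q + 1 - k : ℕ) : ℝ) / ((2 * q + 1 - 2 * k).factorial : ℝ) *
          (π / 6) ^ (((2 * q : ℕ) : ℤ) - 2 * k)) (s := range ((2 * q + 1) / 2 + 1))
          (fun k _ ↦ by positivity) (mem_range.2 (by omega : q < (2 * q + 1) / 2 + 1))
        refine le_trans (le_of_eq ?_) this
        rw [show 2 * q + 1 - q = q + 1 by omega, show 2 * q + 1 - 2 * q = 1 by omega]
        simp
      rw [hq]
      calc _ = 12 / π * (((2 * q + 1).choose q : ℝ) * ((q : ℝ) + 1)) := by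
            have h1 := Nat.choose_mul_succ_eq (2 * q + 1) (q + 1)
            rw [Nat.choose_symm_half, show 2 * q + 1 + 1 - (q + 1) = q + 1 by omega] at h1
            have h2 : ((2 * q + 1 + 1).choose (q + 1) : ℝ) * ((q : ℝ) + 1) =
                ((2 * q + 1).choose q : ℝ) * (2 * (q + 1)) := by
              have : (((2 * q + 1).choose q * (2 * q + 1 + 1) : ℕ) : ℝ) =
                (((2 * q + 1 + 1).choose (q + 1) * (q + 1) : ℕ) : ℝ) := by rw [h1]
              push_cast at this
              linarith
            rw [show 2 * q + 1 + 1 - (q + 1) = q + 1 by omega,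
              show 2 * q + 1 + 1 - 2 * (q + 1) = 0 by omega,
              show ((2 * q + 1 : ℕ) : ℤ) - 2 * ((q + 1 : ℕ) : ℤ) = -1 by push_cast; ring]
            push_cast
            rw [h2]
            simp
            ring
        _ ≤ _ := by gcongr
    · rw [coeffSum, show (2 * q + 1 + 1 + 1) / 2 = (2 * q + 1 + 1) / 2 by omega]
      linarith
  have hπ : 4 * (π / 6) + 12 / π ≤ 4 * Real.sqrt 6 := by
    have h1 := Real.pi_gt_three
    have h2 := Real.pi_le_four
    have h3 : 12 / π ≤ 4 := by
      rw [div_le_iff₀ (by positivity)]; linarith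
    have h4 : 2 ≤ Real.sqrt 6 := Real.le_sqrt_of_sq_le (by norm_num)
    linarith
  calc _ ≤ _ := hextra
    _ = (4 * (π / 6) + 12 / π) * coeffSum m := by ring
    _ ≤ _ := mul_le_mul_of_nonneg_right hπ (coeffSum_nonneg m)

lemma c_eq_coeffSum (m : ℕ) : c m = (-1 / (4 * Real.sqrt 6)) ^ m * coeffSum m := by
  rw [c, coeffSum, div_pow]

lemma c_div_rpow_eq {n : ℕ} (m : ℕ) :
    c m / (n : ℝ) ^ ((m : ℝ) / 2) = coeffSum m * (-1 / (4 * Real.sqrt 6 * Real.sqrt n)) ^ m := by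
  have h : (n : ℝ) ^ ((m : ℝ) / 2) = Real.sqrt n ^ m := by
    rw [Real.sqrt_eq_rpow, ← Real.rpow_natCast, ← Real.rpow_mul n.cast_nonneg]
    congr 1
    ring
  rw [c_eq_coeffSum, h, ← div_div (-1) (4 * Real.sqrt 6), div_pow _ (Real.sqrt n)]
  ring

/-- The leading term of `p n`, normalised as in the definition of the remainder `R`. -/
noncomputable def normalizedMainTerm (n : ℕ) : ℝ :=
  4 * Real.sqrt 3 * n * Real.exp (-(π * Real.sqrt (2 * n / 3))) * partitionMainTerm n

lemma hasSum_normalizedMainTerm {n : ℕ} (hn : 1 ≤ n) :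
    HasSum (fun m : ℕ ↦ c m / (n : ℝ) ^ ((m : ℝ) / 2)) (normalizedMainTerm n) := by
  have hn1 : (1 : ℝ) ≤ n := by exact_mod_cast hn
  have hn0 : (0 : ℝ) < n := by linarith
  set w := 4 * Real.sqrt 6 * Real.sqrt n with hw
  have hw0 : 0 < w := by positivity
  have hw2 : w ^ 2 = 96 * n := by
    rw [hw, mul_pow, mul_pow, Real.sq_sqrt (by norm_num), Real.sq_sqrt hn0.le]; ring
  set v := Real.sqrt (24 * n - 1) with hv
  have hv2 : v ^ 2 = 24 * n - 1 := Real.sq_sqrt (by linarith)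
  have hv0 : 0 < v := Real.sqrt_pos.2 (by linarith)
  have ht2 : (-1 / w) ^ 2 = 1 / (96 * n) := by rw [div_pow, hw2]; norm_num
  have hr2 : (2 * v / w) ^ 2 = 1 - 4 * (-1 / w) ^ 2 := by
    rw [ht2, div_pow, mul_pow, hw2, hv2]
    field_simp
    ring
  have h := hasSum_coeffSum (t := -1 / w) (r := 2 * v / w) (B := (1 - 2 * v / w) * (48 * n))
    (by simpa using hw0.ne') (by positivity) hr2 (by rw [ht2]; field_simp; ring)
  have e : Real.exp (π / 6 * (-1 / w) * ((1 - 2 * v / w) * (48 * n))) *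
      (1 / (2 * v / w) ^ 2 + 2 * (-1 / w) / (π / 6 * (2 * v / w) ^ 3)) = normalizedMainTerm n := by
    have hw' : π * Real.sqrt (2 * n / 3) = π * w / 12 := by
      rw [show (2 * n / 3 : ℝ) = (w / 12) ^ 2 by rw [div_pow, hw2]; ring,
        Real.sqrt_sq (by positivity)]
      ring
    have hs : Real.sqrt 3 * Real.sqrt 12 = 6 := by
      rw [← Real.sqrt_mul (by norm_num), show (3 * 12 : ℝ) = 6 ^ 2 by norm_num,
        Real.sqrt_sq (by norm_num)]
    have harg : π / 6 * (-1 / w) * ((1 - 2 * v / w) * (48 * n)) = -(π * w / 12) + π * v / 6 := by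
      rw [show (48 * n : ℝ) = w ^ 2 / 2 by rw [hw2]; ring]
      field_simp
      ring
    rw [normalizedMainTerm, partitionMainTerm, partitionExponent, ← hv, hw', harg, Real.exp_add,
      ← hv2]
    have hn' : (n : ℝ) = w ^ 2 / 96 := by rw [hw2]; ring
    rw [hn']
    have h3 : Real.sqrt 12 = 6 / Real.sqrt 3 := by
      rw [← hs]; field_simp
    rw [h3]
    field_simp
    ring
  rw [e] at h
  exact h.congr_fun fun m ↦ c_div_rpow_eq m

lemma normalizedMainTerm_sub_sum_bounds {n : ℕ} (hn : 1 ≤ n) (N : ℕ) :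
    0 ≤ normalizedMainTerm n - ∑ m ∈ range (2 * N), c m / (n : ℝ) ^ ((m : ℝ) / 2) ∧
    normalizedMainTerm n - ∑ m ∈ range (2 * N), c m / (n : ℝ) ^ ((m : ℝ) / 2) ≤
      c (2 * N) / (n : ℝ) ^ N := by
  have hn1 : (1 : ℝ) ≤ n := by exact_mod_cast hn
  have hn0 : (0 : ℝ) < n := by linarith
  have halt (m : ℕ) : (-1) ^ m * (coeffSum m / (4 * Real.sqrt 6 * Real.sqrt n) ^ m) =
      c m / (n : ℝ) ^ ((m : ℝ) / 2) := by
    rw [c_div_rpow_eq, div_pow]; ring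
  have hanti : Antitone fun m ↦ coeffSum m / (4 * Real.sqrt 6 * Real.sqrt n) ^ m := by
    refine antitone_nat_of_succ_le fun m ↦ ?_
    rw [pow_succ, div_le_div_iff₀ (by positivity) (by positivity)]
    have h1 : 1 ≤ Real.sqrt n := Real.one_le_sqrt.2 hn1
    have h2 := coeffSum_succ_le m
    have h3 : 4 * Real.sqrt 6 * coeffSum m ≤ coeffSum m * (4 * Real.sqrt 6 * Real.sqrt n) := by
      rw [mul_comm (coeffSum m), mul_assoc _ (Real.sqrt n), mul_comm (Real.sqrt n), ← mul_assoc]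
      exact le_mul_of_one_le_right (mul_nonneg (by positivity) (coeffSum_nonneg m)) h1
    calc _ ≤ coeffSum m * (4 * Real.sqrt 6 * Real.sqrt n) *
            (4 * Real.sqrt 6 * Real.sqrt n) ^ m := by
          gcongr; exact h2.trans h3
      _ = _ := by ring
  have hlim : Tendsto (fun M ↦ ∑ m ∈ range M,
      (-1) ^ m * (coeffSum m / (4 * Real.sqrt 6 * Real.sqrt n) ^ m)) atTop
      (𝓝 (normalizedMainTerm n)) := by
    simpa only [halt] using (hasSum_normalizedMainTerm hn).tendsto_sum_nat
  have hlo := hanti.alternating_series_le_tendsto hlim N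
  have hhi := hanti.tendsto_le_alternating_series hlim N
  simp only [halt] at hlo hhi
  rw [sum_range_succ, show ((2 * N : ℕ) : ℝ) / 2 = (N : ℕ) by push_cast; ring,
    Real.rpow_natCast] at hhi
  exact ⟨by linarith, by linarith⟩

/-- The generating function of partitions into parts of size at most `m`, evaluated at `Q`
modulo `Q ^ M`. -/
def packedPartitions (Q M : ℕ) : ℕ → ℕ
  | 0 => 1
  | m + 1 => packedPartitions Q M m *
      ((Q ^ ((m + 1) * (M / (m + 1) + 1)) - 1) / (Q ^ (m + 1) - 1)) % Q ^ M

/-- Runs a test on the successive base-`Q` digits of `T`, the first of which has index `n`. -/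
def testDigits (test : ℕ → ℕ → Bool) (Q : ℕ) : ℕ → ℕ → ℕ → Bool
  | 0, _, _ => true
  | f + 1, n, T => test n (T % Q) && testDigits test Q f (n + 1) (T / Q)

/-- `K ^ t * t !` times the `t`-th Taylor polynomial of the exponential function at `y / K`. -/
def expNumerator (K y : ℕ) : ℕ → ℕ
  | 0 => 1
  | t + 1 => K * (t + 1) * expNumerator K y t + y ^ (t + 1)

/-- `f` steps of Newton's iteration for the integer square root of `X`, starting at `s`. -/
def newtonSqrt (X : ℕ) : ℕ → ℕ → ℕ
  | 0, s => s
  | f + 1, s => newtonSqrt X f ((s + X / s) / 2)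

/-- The denominator of the fixed point numbers used in the verification for small `n`. -/
def fixedScale : ℕ := 10 ^ 25

/-- A fixed point lower bound for the exponential of `64 * y`. -/
def expLower (y : ℕ) : ℕ :=
  (fixedScale * expNumerator fixedScale y 20 / (fixedScale ^ 20 * Nat.factorial 20)) ^ 64 /
    fixedScale ^ 63

/-- A fixed point upper bound for the exponential of `64 * y`. -/
def expUpper (y : ℕ) : ℕ :=
  (fixedScale * expNumerator fixedScale y 20 / (fixedScale ^ 20 * Nat.factorial 20) + 2) ^ 64 /
    fixedScale ^ 63 + 1

/-- The fixed point approximation to `√3` from below. -/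
def sqrtThree : ℕ := 17320508075688772935274463

/-- The final comparison in `partitionTest`, where `P` is compared with the main term
by means of fixed point bounds `a` and `b` for `6` times the exponent, and `x`
and `y` for the exponential of half the exponent. -/
def partitionComparison (n P a b x y : ℕ) : Bool :=
  Nat.blt
    (8 * (sqrtThree + 1) ^ 2 * n * (fixedScale - 6 * fixedScale ^ 3 / b) * y ^ 2)
    (4 * P * (24 * n - 1) * fixedScale ^ 4 * (sqrtThree + 1) * n +
      x * (24 * n - 1) * fixedScale ^ 4) &&
  Nat.blt
    (4 * P * (24 * n - 1) * fixedScale ^ 4 * (sqrtThree + 1) * n +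
      8 * sqrtThree * (6 * fixedScale ^ 3 / a + 1) * x ^ 2 *
        (sqrtThree + 1) * n)
    (8 * sqrtThree * fixedScale * x ^ 2 * (sqrtThree + 1) * n +
      x * (24 * n - 1) * fixedScale ^ 4)

/-- Given fixed point bounds `a` and `b` for `π √(24 n - 1)`, tests whether `P` is
close to the main term. -/
def exponentTest (n P a b : ℕ) : Bool :=
  Nat.ble (2 * (b / (768 * fixedScale) + 1)) fixedScale &&
  partitionComparison n P a b (expLower (a / (768 * fixedScale)))
    (expUpper (b / (768 * fixedScale) + 1))

/-- Given an approximation `v` to `√(24 n - 1)`, tests whether `P` is close to the main term. -/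
def sqrtTest (n P v : ℕ) : Bool :=
  Nat.ble (v ^ 2) ((24 * n - 1) * fixedScale ^ 2) &&
  Nat.ble ((24 * n - 1) * fixedScale ^ 2) ((v + 1) ^ 2) &&
  exponentTest n P (31415926535897932384600000 * v) (31415926535897932384700000 * (v + 1))

/-- Tests whether `P` is close to the main term of the number of partitions of `n`. -/
def partitionTest (n P : ℕ) : Bool :=
  Nat.beq n 0 ||
    sqrtTest n P (newtonSqrt ((24 * n - 1) * fixedScale ^ 2) 12 (120 * fixedScale))

lemma testDigits_packedPartitions :
    testDigits partitionTest (2 ^ 96) 600 0 (packedPartitions (2 ^ 96) 600 600) = true := by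
  decide +kernel

lemma boundedPartitions_one (n : ℕ) : boundedPartitions 1 n = 1 := by
  induction n with
  | zero => rw [boundedPartitions_succ, boundedPartitions_zero]; simp
  | succ n ih => rw [boundedPartitions_succ, boundedPartitions_zero]; simp [ih]

lemma boundedPartitions_le_succ (m n : ℕ) :
    boundedPartitions (m + 1) n ≤ boundedPartitions (m + 1) (n + 1) := by
  induction m generalizing n with
  | zero => simp [boundedPartitions_one]
  | succ m ih =>
    induction n using Nat.strong_induction_on with
    | _ n ihn =>
      rw [boundedPartitions_succ (m + 1) n, boundedPartitions_succ (m + 1) (n + 1)]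
      refine Nat.add_le_add (ih n) ?_
      by_cases h : m + 1 + 1 ≤ n
      · rw [if_pos h, if_pos (by omega), Nat.sub_add_comm h]
        exact ihn _ (by omega)
      · simp [h]

lemma boundedPartitions_lt_two_pow {n : ℕ} (hn : n ≤ 600) (m : ℕ) :
    boundedPartitions m n < 2 ^ 96 := by
  have hmono : boundedPartitions 600 n ≤ boundedPartitions 600 600 :=
    monotone_nat_of_le_succ (boundedPartitions_le_succ 599) hn
  have h1 : (boundedPartitions m n : ℝ) ≤ p 600 := by
    rw [p, ← boundedPartitions_eq le_rfl]
    rw [boundedPartitions_eq hn] at hmono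
    exact_mod_cast (boundedPartitions_le m n).trans hmono
  have h2 := (abs_lt.1 (abs_p_sub_partitionMainTerm_lt_of_large (n := 600) le_rfl)).2
  have h3 : partitionExponent 600 ≤ 64 := by
    have h : Real.sqrt (24 * (600 : ℕ) - 1) ≤ 120 :=
      Real.sqrt_le_iff.2 ⟨by norm_num, by norm_num⟩
    have hπ := Real.pi_lt_d2
    rw [partitionExponent]
    calc π * Real.sqrt (24 * (600 : ℕ) - 1) / 6 ≤ 3.15 * 120 / 6 := by gcongr
      _ ≤ 64 := by norm_num
  have h0 : 0 < partitionExponent 600 := by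
    rw [partitionExponent]
    have : (0 : ℝ) < 24 * (600 : ℕ) - 1 := by norm_num
    positivity
  have hexp : Real.exp (partitionExponent 600) ≤ 2.7182818286 ^ 64 := by
    calc _ ≤ Real.exp 64 := Real.exp_le_exp.2 h3
      _ = Real.exp 1 ^ 64 := by rw [← Real.exp_nat_mul]; norm_num
      _ ≤ _ := by gcongr; exact Real.exp_one_lt_d9.le
  have h4 : partitionMainTerm 600 ≤ Real.exp (partitionExponent 600) := by
    rw [partitionMainTerm]
    refine mul_le_of_le_one_left (Real.exp_pos _).le ?_
    have h12 : Real.sqrt 12 ≤ 4 := Real.sqrt_le_iff.2 ⟨by norm_num, by norm_num⟩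
    have : 0 ≤ 1 / partitionExponent 600 := by positivity
    have hsq : Real.sqrt 12 / (24 * (600 : ℕ) - 1) ≤ 1 := by
      rw [div_le_one (by norm_num)]
      push_cast
      linarith
    exact (mul_le_of_le_one_right (div_nonneg (Real.sqrt_nonneg _) (by norm_num))
      (by linarith)).trans hsq
  have h5 : Real.exp (partitionExponent 600 / 2) / (4 * Real.sqrt 3 * (600 : ℕ)) ≤
      Real.exp (partitionExponent 600) := by
    have h3' : 1 ≤ Real.sqrt 3 := Real.one_le_sqrt.2 (by norm_num)
    refine (div_le_self (Real.exp_pos _).le (by push_cast; linarith)).trans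
      (Real.exp_le_exp.2 (by linarith))
  have h6 : (boundedPartitions m n : ℝ) < 2 ^ 96 := by
    have : (2 * 2.7182818286 ^ 64 : ℝ) < 2 ^ 96 := by norm_num
    linarith
  exact_mod_cast h6

lemma sum_mul_pow_lt {Q : ℕ} {b : ℕ → ℕ} {M : ℕ} (hb : ∀ i < M, b i < Q) :
    ∑ i ∈ range M, b i * Q ^ i < Q ^ M := by
  induction M with
  | zero => simp
  | succ M ih =>
    rw [sum_range_succ]
    have h1 := ih fun i hi ↦ hb i (by omega)
    calc _ < Q ^ M + b M * Q ^ M := by gcongr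
      _ = (b M + 1) * Q ^ M := by ring
      _ ≤ Q * Q ^ M := by gcongr; exact hb M (by omega)
      _ = _ := by ring

lemma sum_boundedPartitions_succ {Q M m : ℕ} (hm : m + 1 ≤ M) :
    ∑ i ∈ range M, boundedPartitions (m + 1) i * Q ^ i ≡
      ∑ i ∈ range M, boundedPartitions m i * Q ^ i +
      Q ^ (m + 1) * ∑ i ∈ range M, boundedPartitions (m + 1) i * Q ^ i [MOD Q ^ M] := by
  obtain ⟨L, rfl⟩ := Nat.exists_eq_add_of_le hm
  have h1 : ∑ i ∈ range (m + 1 + L), boundedPartitions (m + 1) i * Q ^ i =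
      ∑ i ∈ range (m + 1 + L), boundedPartitions m i * Q ^ i +
      Q ^ (m + 1) * ∑ i ∈ range L, boundedPartitions (m + 1) i * Q ^ i := by
    have h2 : ∑ i ∈ range (m + 1 + L), (if m + 1 ≤ i then
        boundedPartitions (m + 1) (i - (m + 1)) else 0) * Q ^ i =
        Q ^ (m + 1) * ∑ i ∈ range L, boundedPartitions (m + 1) i * Q ^ i := by
      rw [sum_range_add, sum_eq_zero, zero_add, mul_sum]
      · refine sum_congr rfl fun i _ ↦ ?_
        rw [if_pos (by omega), Nat.add_sub_cancel_left, pow_add]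
        ring
      · intro i hi
        rw [if_neg (by have := mem_range.1 hi; omega), zero_mul]
    rw [← h2, ← sum_add_distrib]
    refine sum_congr rfl fun i _ ↦ ?_
    rw [boundedPartitions_succ, add_mul]
  rw [h1]
  refine Nat.ModEq.add_left _ ?_
  rw [← h1, add_comm (m + 1) L, sum_range_add, mul_add]
  nth_rewrite 1 [← add_zero (Q ^ (m + 1) * _)]
  refine Nat.ModEq.add_left _ (Nat.modEq_zero_iff_dvd.2 ?_).symm
  rw [mul_sum]
  refine dvd_sum fun i _ ↦ ⟨boundedPartitions (m + 1) (L + i) * Q ^ i, ?_⟩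
  ring

lemma sum_boundedPartitions_modEq {Q M m : ℕ} (hQ : 2 ≤ Q) (hm : m ≤ M) (hM : 0 < M) :
    ∑ i ∈ range M, boundedPartitions m i * Q ^ i ≡ packedPartitions Q M m [MOD Q ^ M] := by
  induction m with
  | zero =>
    have : ∑ i ∈ range M, boundedPartitions 0 i * Q ^ i = 1 := by
      rw [sum_eq_single_of_mem 0 (mem_range.2 hM)]
      · simp [boundedPartitions_zero]
      · intro i _ hi
        simp [boundedPartitions_zero, hi]
    rw [this]
    rfl
  | succ m ih =>
    have ih' := ih (by omega)
    have hrec := sum_boundedPartitions_succ (Q := Q) hm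
    rw [packedPartitions]
    set S := ∑ i ∈ range M, boundedPartitions m i * Q ^ i
    set T := ∑ i ∈ range M, boundedPartitions (m + 1) i * Q ^ i
    set L := M / (m + 1) + 1 with hL
    have hML : M ≤ (m + 1) * L := by
      rw [hL, mul_add, mul_one]
      exact (Nat.lt_mul_div_succ M (Nat.succ_pos m)).le
    have hG : (Q ^ ((m + 1) * L) - 1) / (Q ^ (m + 1) - 1) = ∑ i ∈ range L, (Q ^ (m + 1)) ^ i := by
      rw [Nat.geomSum_eq (hQ.trans (Nat.le_self_pow (Nat.succ_ne_zero m) Q)), pow_mul]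
    rw [hG]
    refine Nat.ModEq.trans ?_ (Nat.mod_modEq _ _).symm
    refine Nat.ModEq.trans ?_ (ih'.mul_right _)
    have hgeom := geom_sum_mul ((Q : ℤ) ^ (m + 1)) L
    rw [← Int.natCast_modEq_iff] at hrec ⊢
    obtain ⟨d, hd⟩ := hrec.dvd
    have hdvd : (Q : ℤ) ^ M ∣ ((Q : ℤ) ^ (m + 1)) ^ L := by
      rw [← pow_mul]; exact pow_dvd_pow _ hML
    obtain ⟨e, he⟩ := hdvd
    rw [he] at hgeom
    refine Int.modEq_iff_dvd.2 ⟨d * ∑ i ∈ range L, ((Q : ℤ) ^ (m + 1)) ^ i - T * e, ?_⟩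
    push_cast at hd ⊢
    linear_combination (∑ i ∈ range L, ((Q : ℤ) ^ (m + 1)) ^ i) * hd - (T : ℤ) * hgeom

lemma testDigits_sum {test : ℕ → ℕ → Bool} {Q : ℕ} {b : ℕ → ℕ} {f n : ℕ}
    (hb : ∀ i < f, b i < Q) (h : testDigits test Q f n (∑ i ∈ range f, b i * Q ^ i) = true)
    {i : ℕ} (hi : i < f) : test (n + i) (b i) = true := by
  induction f generalizing n b i with
  | zero => omega
  | succ f ih =>
    have hQ : 0 < Q := (Nat.zero_le _).trans_lt (hb 0 (by omega))
    have hsum : ∑ i ∈ range (f + 1), b i * Q ^ i =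
        b 0 + Q * ∑ i ∈ range f, b (i + 1) * Q ^ i := by
      rw [sum_range_succ', mul_sum, add_comm, pow_zero, mul_one]
      congr 1
      refine sum_congr rfl fun i _ ↦ ?_
      ring
    have h0 := hb 0 (by omega)
    rw [testDigits, hsum, Nat.add_mul_mod_self_left, Nat.mod_eq_of_lt h0,
      Nat.add_mul_div_left _ _ hQ, Nat.div_eq_of_lt h0, zero_add, Bool.and_eq_true] at h
    cases i with
    | zero => exact h.1
    | succ i =>
      have := ih (b := fun i ↦ b (i + 1)) (fun i hi ↦ hb (i + 1) (by omega)) h.2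
        (i := i) (by omega)
      rwa [add_assoc, add_comm 1] at this

lemma partitionTest_card {n : ℕ} (hn : n < 600) :
    partitionTest n (Fintype.card (Nat.Partition n)) = true := by
  have hlt : ∀ i < 600, boundedPartitions 600 i < 2 ^ 96 := fun i hi ↦
    boundedPartitions_lt_two_pow (by omega) 600
  have hpack : packedPartitions (2 ^ 96) 600 600 =
      ∑ i ∈ range 600, boundedPartitions 600 i * (2 ^ 96) ^ i := by
    have h := sum_boundedPartitions_modEq (Q := 2 ^ 96) (M := 600) (m := 600) (by norm_num) le_rfl
      (by norm_num)
    have hmod : packedPartitions (2 ^ 96) 600 600 < (2 ^ 96) ^ 600 :=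
      Nat.mod_lt _ (by positivity)
    exact (h.eq_of_lt_of_lt (sum_mul_pow_lt hlt) hmod).symm
  have h := testDigits_packedPartitions
  rw [hpack] at h
  have := testDigits_sum hlt h hn
  rwa [zero_add, boundedPartitions_eq (by omega)] at this

lemma fixedScale_pos : (0 : ℝ) < fixedScale := by norm_num [fixedScale]

lemma cast_expNumerator_div {K : ℕ} (hK : 0 < K) (y t : ℕ) :
    (expNumerator K y t : ℝ) / (K ^ t * t.factorial) =
      ∑ i ∈ range (t + 1), ((y : ℝ) / K) ^ i / i.factorial := by
  induction t with
  | zero => simp [expNumerator]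
  | succ t ih =>
    rw [sum_range_succ, ← ih, expNumerator, Nat.factorial_succ]
    push_cast
    rw [div_pow]
    field_simp
    ring

lemma cast_div_le_and_lt (a : ℕ) {b : ℕ} (hb : 0 < b) :
    ((a / b : ℕ) : ℝ) ≤ a / b ∧ (a : ℝ) / b < ((a / b : ℕ) : ℝ) + 1 := by
  refine ⟨Nat.cast_div_le, ?_⟩
  rw [div_lt_iff₀ (by exact_mod_cast hb)]
  exact_mod_cast (Nat.lt_mul_div_succ a hb).trans_eq (mul_comm _ _)

lemma expLower_div_le (y : ℕ) :
    (expLower y : ℝ) / fixedScale ≤ Real.exp ((y : ℝ) / fixedScale) ^ 64 := by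
  have hK := fixedScale_pos
  have hK' : 0 < fixedScale := by exact_mod_cast hK
  set u := fixedScale * expNumerator fixedScale y 20 / (fixedScale ^ 20 * Nat.factorial 20)
    with hu
  have h1 : (u : ℝ) / fixedScale ≤ Real.exp ((y : ℝ) / fixedScale) := by
    have h := (cast_div_le_and_lt (fixedScale * expNumerator fixedScale y 20)
      (b := fixedScale ^ 20 * Nat.factorial 20) (by positivity)).1
    refine le_trans ?_ (Real.sum_le_exp_of_nonneg (by positivity) 21)
    rw [← cast_expNumerator_div hK', div_le_iff₀ hK]
    refine h.trans_eq ?_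
    push_cast
    ring
  have h2 : (expLower y : ℝ) ≤ u ^ 64 / fixedScale ^ 63 := by
    have := (cast_div_le_and_lt (u ^ 64) (b := fixedScale ^ 63) (by positivity)).1
    rw [expLower]
    exact_mod_cast this
  calc (expLower y : ℝ) / fixedScale ≤ u ^ 64 / fixedScale ^ 63 / fixedScale := by gcongr
    _ = (u / fixedScale) ^ 64 := by rw [div_pow, div_div, ← pow_succ]
    _ ≤ _ := by gcongr

lemma le_expUpper_div {y : ℕ} (hy : 2 * y ≤ fixedScale) :
    Real.exp ((y : ℝ) / fixedScale) ^ 64 ≤ (expUpper y : ℝ) / fixedScale := by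
  have hK := fixedScale_pos
  have hK' : 0 < fixedScale := by exact_mod_cast hK
  set u := fixedScale * expNumerator fixedScale y 20 / (fixedScale ^ 20 * Nat.factorial 20)
    with hu
  have hy' : (y : ℝ) / fixedScale ≤ 1 / 2 := by
    rw [div_le_div_iff₀ hK two_pos]
    exact_mod_cast (by omega : y * 2 ≤ 1 * fixedScale)
  have h1 : Real.exp ((y : ℝ) / fixedScale) ≤ ((u + 2 : ℕ) : ℝ) / fixedScale := by
    have h := (cast_div_le_and_lt (fixedScale * expNumerator fixedScale y 20)
      (b := fixedScale ^ 20 * Nat.factorial 20) (by positivity)).2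
    have h21 := Real.exp_bound' (x := (y : ℝ) / fixedScale) (by positivity) (by linarith)
      (n := 21) (by norm_num)
    rw [← cast_expNumerator_div hK'] at h21
    have htail : ((y : ℝ) / fixedScale) ^ 21 * ((21 : ℕ) + 1) /
        ((Nat.factorial 21 : ℕ) * (21 : ℕ)) ≤ 1 / fixedScale := by
      calc _ ≤ ((1 : ℝ) / 2) ^ 21 * ((21 : ℕ) + 1) / ((Nat.factorial 21 : ℕ) * (21 : ℕ)) := by
            gcongr
        _ ≤ _ := by norm_num [fixedScale, Nat.factorial]
    have h3 : (expNumerator fixedScale y 20 : ℝ) / (fixedScale ^ 20 * Nat.factorial 20) ≤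
        (u + 1) / fixedScale := by
      rw [le_div_iff₀ hK]
      refine le_trans (le_of_eq ?_) h.le
      push_cast
      ring
    refine h21.trans ((add_le_add h3 htail).trans_eq ?_)
    push_cast
    ring
  have h2 : ((u + 2 : ℕ) : ℝ) ^ 64 / fixedScale ^ 63 ≤ expUpper y := by
    have := (cast_div_le_and_lt ((u + 2) ^ 64) (b := fixedScale ^ 63) (by positivity)).2.le
    rw [expUpper]
    exact_mod_cast this
  calc _ ≤ (((u + 2 : ℕ) : ℝ) / fixedScale) ^ 64 := by gcongr
    _ = ((u + 2 : ℕ) : ℝ) ^ 64 / fixedScale ^ 63 / fixedScale := by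
      rw [div_pow, div_div, ← pow_succ]
    _ ≤ _ := by gcongr

lemma sqrt_three_bounds : (sqrtThree : ℝ) / fixedScale ≤ Real.sqrt 3 ∧
    Real.sqrt 3 ≤ ((sqrtThree : ℝ) + 1) / fixedScale := by
  rw [fixedScale, sqrtThree]
  exact ⟨Real.le_sqrt_of_sq_le (by norm_num), Real.sqrt_le_iff.2 ⟨by norm_num, by norm_num⟩⟩

/-- Soundness of `partitionComparison`, where `w` stands for `π √(24 n - 1)` and `X` for
the exponential of half the exponent. -/
lemma abs_sub_lt_of_partitionComparison {n P a b x y : ℕ} {w X : ℝ} (hn : 1 ≤ n)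
    (h : partitionComparison n P a b x y = true) (hw : 6 ≤ w) (ha : 0 < a)
    (haw : (a : ℝ) / fixedScale ^ 2 ≤ w) (hwb : w ≤ (b : ℝ) / fixedScale ^ 2)
    (hxX : (x : ℝ) / fixedScale ≤ X) (hXy : X ≤ (y : ℝ) / fixedScale) :
    |(P : ℝ) - Real.sqrt 12 / (24 * n - 1) * (1 - 1 / (w / 6)) * X ^ 2| <
      X / (4 * Real.sqrt 3 * n) := by
  have hK := fixedScale_pos
  have hn1 : (1 : ℝ) ≤ n := by exact_mod_cast hn
  have hD : (0 : ℝ) < 24 * n - 1 := by linarith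
  have hDc : ((24 * n - 1 : ℕ) : ℝ) = 24 * n - 1 := by
    rw [Nat.cast_sub (by omega)]; push_cast; ring
  have ha' : (0 : ℝ) < a := by exact_mod_cast ha
  have hb' : (0 : ℝ) < b := by
    have : 0 < (b : ℝ) / fixedScale ^ 2 := by linarith
    exact (div_pos_iff_of_pos_right (by positivity)).1 this
  rw [partitionComparison, Bool.and_eq_true, Nat.blt_eq, Nat.blt_eq] at h
  obtain ⟨hup, hlo⟩ := h
  have hup' := (Nat.cast_lt (α := ℝ)).2 hup
  have hlo' := (Nat.cast_lt (α := ℝ)).2 hlo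
  push_cast [hDc] at hup' hlo'
  obtain ⟨hql, hqu⟩ := sqrt_three_bounds
  have hq : 0 < Real.sqrt 3 := by positivity
  have h12 : Real.sqrt 12 = 2 * Real.sqrt 3 := by
    rw [show (12 : ℝ) = 2 ^ 2 * 3 by norm_num, Real.sqrt_mul (by norm_num),
      Real.sqrt_sq (by norm_num)]
  have hX : 0 ≤ X := le_trans (by positivity) hxX
  have hm0 : 0 ≤ 1 - 1 / (w / 6) := by
    rw [sub_nonneg, div_le_one (by linarith)]
    linarith
  have hml : (fixedScale - (((6 * fixedScale ^ 3 / a : ℕ) : ℝ) + 1)) / fixedScale ≤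
      1 - 1 / (w / 6) := by
    have h1 := (cast_div_le_and_lt (6 * fixedScale ^ 3) ha).2.le
    have h2 : 1 / (w / 6) ≤ 6 / ((a : ℝ) / fixedScale ^ 2) := by
      rw [one_div_div]
      gcongr
    have h3 : 6 / ((a : ℝ) / fixedScale ^ 2) =
        ((6 * fixedScale ^ 3 : ℕ) : ℝ) / a / fixedScale := by
      push_cast
      field_simp
    have h4 : ((6 * fixedScale ^ 3 : ℕ) : ℝ) / a / fixedScale ≤
        (((6 * fixedScale ^ 3 / a : ℕ) : ℝ) + 1) / fixedScale := by gcongr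
    rw [sub_div, div_self hK.ne']
    linarith
  have hmu : 1 - 1 / (w / 6) ≤ ((fixedScale - 6 * fixedScale ^ 3 / b : ℕ) : ℝ) / fixedScale := by
    have h1 := (cast_div_le_and_lt (6 * fixedScale ^ 3) (b := b) (by exact_mod_cast hb')).1
    have h2 : 6 / ((b : ℝ) / fixedScale ^ 2) ≤ 1 / (w / 6) := by
      rw [one_div_div]
      gcongr
    have h3 : 6 / ((b : ℝ) / fixedScale ^ 2) =
        ((6 * fixedScale ^ 3 : ℕ) : ℝ) / b / fixedScale := by
      push_cast
      field_simp
    have h4 : (fixedScale : ℝ) - ((6 * fixedScale ^ 3 / b : ℕ) : ℝ) ≤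
        ((fixedScale - 6 * fixedScale ^ 3 / b : ℕ) : ℝ) := by
      rw [sub_le_iff_le_add]
      exact_mod_cast le_tsub_add
    have h5 : ((6 * fixedScale ^ 3 / b : ℕ) : ℝ) / fixedScale ≤
        ((6 * fixedScale ^ 3 : ℕ) : ℝ) / b / fixedScale := by gcongr
    calc 1 - 1 / (w / 6) ≤ (fixedScale - ((6 * fixedScale ^ 3 / b : ℕ) : ℝ)) / fixedScale := by
          rw [sub_div, div_self hK.ne']
          linarith
      _ ≤ _ := by gcongr
  rw [h12]
  set k : ℝ := (fixedScale : ℝ)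
  set A : ℝ := ((6 * fixedScale ^ 3 / a : ℕ) : ℝ)
  set C : ℝ := ((fixedScale - 6 * fixedScale ^ 3 / b : ℕ) : ℝ)
  set m : ℝ := 1 - 1 / (w / 6)
  have hql0 : (0 : ℝ) ≤ sqrtThree := Nat.cast_nonneg _
  have hqu0 : (0 : ℝ) < (sqrtThree : ℝ) + 1 := by positivity
  generalize (sqrtThree : ℝ) + 1 = qu at *
  generalize (sqrtThree : ℝ) = ql at *
  generalize (24 * n - 1 : ℝ) = D at *
  have hC : 0 ≤ C := Nat.cast_nonneg _
  have hx : x / (4 * qu * n) ≤ X / (4 * Real.sqrt 3 * n) := by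
    calc (x : ℝ) / (4 * qu * n) = x / k / (4 * (qu / k) * n) := by field_simp
      _ ≤ _ := by gcongr
  have hupper : 2 * Real.sqrt 3 / D * m * X ^ 2 < P + x / (4 * qu * n) := by
    calc 2 * Real.sqrt 3 / D * m * X ^ 2
        ≤ 2 * (qu / k) / D * (C / k) * (y / k) ^ 2 := by gcongr
      _ = 8 * qu ^ 2 * n * C * y ^ 2 / (D * k ^ 4 * (4 * qu * n)) := by
        field_simp
        ring
      _ < (4 * P * D * k ^ 4 * qu * n + x * D * k ^ 4) /
          (D * k ^ 4 * (4 * qu * n)) := by gcongr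
      _ = _ := by
        field_simp
  have hlower : P < 2 * Real.sqrt 3 / D * m * X ^ 2 + x / (4 * qu * n) := by
    have h1 : 2 * (ql / k) / D * (x / k) ^ 2 * ((k - (A + 1)) / k) ≤
        2 * Real.sqrt 3 / D * X ^ 2 * m := by
      calc _ ≤ 2 * (ql / k) / D * (x / k) ^ 2 * m := by gcongr
        _ ≤ _ := by gcongr
    have h2 : P - x / (4 * qu * n) <
        2 * (ql / k) / D * (x / k) ^ 2 * ((k - (A + 1)) / k) := by
      calc P - x / (4 * qu * n) = (4 * P * D * k ^ 4 * qu * n -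
            x * D * k ^ 4) / (D * k ^ 4 * (4 * qu * n)) := by
            field_simp
        _ < (8 * ql * k * x ^ 2 * qu * n - 8 * ql * (A + 1) * x ^ 2 * qu * n) /
            (D * k ^ 4 * (4 * qu * n)) := by
            refine div_lt_div_of_pos_right ?_ (by positivity)
            linarith
        _ = _ := by
            field_simp
            ring
    linarith
  rw [abs_sub_lt_iff]
  constructor <;> linarith

lemma abs_p_sub_partitionMainTerm_lt_of_small {n : ℕ} (hn : 1 ≤ n) (hn' : n < 600) :
    |p n - partitionMainTerm n| <
      Real.exp (partitionExponent n / 2) / (4 * Real.sqrt 3 * n) := by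
  have hK := fixedScale_pos
  have hK' : 0 < fixedScale := by exact_mod_cast hK
  have hn1 : (1 : ℝ) ≤ n := by exact_mod_cast hn
  have h := partitionTest_card hn'
  rw [partitionTest, Bool.or_eq_true, Nat.beq_eq, or_iff_right (by omega), sqrtTest,
    Bool.and_eq_true, Bool.and_eq_true, Nat.ble_eq, Nat.ble_eq] at h
  generalize newtonSqrt ((24 * n - 1) * fixedScale ^ 2) 12 (120 * fixedScale) = v at h
  obtain ⟨⟨hv1, hv2⟩, h⟩ := h
  rw [exponentTest, Bool.and_eq_true, Nat.ble_eq] at h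
  obtain ⟨hy, h⟩ := h
  have hDc : ((24 * n - 1 : ℕ) : ℝ) = 24 * n - 1 := by
    rw [Nat.cast_sub (by omega)]; push_cast; ring
  have hv1' : (v : ℝ) / fixedScale ≤ Real.sqrt (24 * n - 1) := by
    refine Real.le_sqrt_of_sq_le ?_
    rw [div_pow, div_le_iff₀ (by positivity), ← hDc]
    exact_mod_cast hv1
  have hv2' : Real.sqrt (24 * n - 1) ≤ ((v + 1 : ℕ) : ℝ) / fixedScale := by
    refine Real.sqrt_le_iff.2 ⟨by positivity, ?_⟩
    rw [div_pow, le_div_iff₀ (by positivity), ← hDc]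
    exact_mod_cast hv2
  have hπ1 : (31415926535897932384600000 : ℝ) / fixedScale ≤ π := by
    refine le_trans ?_ Real.pi_gt_d20.le
    norm_num [fixedScale]
  have hπ2 : π ≤ (31415926535897932384700000 : ℝ) / fixedScale := by
    refine Real.pi_lt_d20.le.trans ?_
    norm_num [fixedScale]
  set w := π * Real.sqrt (24 * n - 1) with hw
  have hw6 : 6 ≤ w := by
    have h1 : 2 ≤ Real.sqrt (24 * n - 1) := Real.le_sqrt_of_sq_le (by linarith)
    have h2 := Real.pi_gt_three
    calc (6 : ℝ) = 3 * 2 := by norm_num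
      _ ≤ w := by rw [hw]; gcongr
  set a := 31415926535897932384600000 * v with ha
  set b := 31415926535897932384700000 * (v + 1) with hb
  have haw : (a : ℝ) / fixedScale ^ 2 ≤ w := by
    calc (a : ℝ) / fixedScale ^ 2 = 31415926535897932384600000 / fixedScale *
          (v / fixedScale) := by rw [ha]; push_cast; ring
      _ ≤ w := by rw [hw]; gcongr
  have hwb : w ≤ (b : ℝ) / fixedScale ^ 2 := by
    calc w ≤ 31415926535897932384700000 / fixedScale * (((v + 1 : ℕ) : ℝ) / fixedScale) := by
          rw [hw]; gcongr
      _ = _ := by rw [hb]; push_cast; ring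
  have ha0 : 0 < a := by
    rw [ha]
    refine Nat.mul_pos (by norm_num) (Nat.pos_of_ne_zero ?_)
    rintro rfl
    have h1 : (24 * n - 1) * fixedScale ^ 2 ≥ 23 * fixedScale ^ 2 := by gcongr; omega
    have h2 : 1 < 23 * fixedScale ^ 2 := by norm_num [fixedScale]
    simp only [zero_add, one_pow] at hv2
    omega
  have hexp : Real.exp (w / 12) = Real.exp (w / 768) ^ 64 := by
    rw [← Real.exp_nat_mul]
    congr 1
    push_cast
    ring
  have hX1 : (expLower (a / (768 * fixedScale)) : ℝ) / fixedScale ≤ Real.exp (w / 12) := by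
    rw [hexp]
    refine (expLower_div_le _).trans ?_
    have h1 := (cast_div_le_and_lt a (b := 768 * fixedScale) (by positivity)).1
    refine pow_le_pow_left₀ (Real.exp_pos _).le (Real.exp_le_exp.2 ?_) 64
    calc ((a / (768 * fixedScale) : ℕ) : ℝ) / fixedScale
        ≤ a / ((768 * fixedScale : ℕ) : ℝ) / fixedScale := by gcongr
      _ = a / fixedScale ^ 2 / 768 := by push_cast; field_simp
      _ ≤ w / 768 := by gcongr
  have hX2 : Real.exp (w / 12) ≤ (expUpper (b / (768 * fixedScale) + 1) : ℝ) / fixedScale := by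
    rw [hexp]
    refine le_trans ?_ (le_expUpper_div hy)
    have h1 := (cast_div_le_and_lt b (b := 768 * fixedScale) (by positivity)).2.le
    refine pow_le_pow_left₀ (Real.exp_pos _).le (Real.exp_le_exp.2 ?_) 64
    calc w / 768 ≤ b / fixedScale ^ 2 / 768 := by gcongr
      _ = b / ((768 * fixedScale : ℕ) : ℝ) / fixedScale := by push_cast; field_simp
      _ ≤ _ := by push_cast at h1 ⊢; gcongr
  have hmain := abs_sub_lt_of_partitionComparison hn h hw6 ha0 haw hwb hX1 hX2
  have hsq : Real.exp (w / 6) = Real.exp (w / 12) ^ 2 := by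
    rw [← Real.exp_nat_mul]
    congr 1
    push_cast
    ring
  rwa [p, partitionMainTerm, partitionExponent, ← hw, hsq, div_div,
    (by norm_num : (6 : ℝ) * 2 = 12)]

lemma abs_p_sub_partitionMainTerm_lt {n : ℕ} (hn : 1 ≤ n) :
    |p n - partitionMainTerm n| <
      Real.exp (partitionExponent n / 2) / (4 * Real.sqrt 3 * n) := by
  rcases lt_or_ge n 600 with h | h
  · exact abs_p_sub_partitionMainTerm_lt_of_small hn h
  · exact abs_p_sub_partitionMainTerm_lt_of_large h

lemma partitionExponent_le (n : ℕ) : partitionExponent n ≤ π * Real.sqrt (2 * n / 3) := by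
  have h : Real.sqrt (24 * n - 1) ≤ 6 * Real.sqrt (2 * n / 3) := by
    refine Real.sqrt_le_iff.2 ⟨by positivity, ?_⟩
    rw [mul_pow, Real.sq_sqrt (by positivity)]
    linarith
  rw [partitionExponent, div_le_iff₀ (by norm_num)]
  nlinarith [Real.pi_pos]

theorem stmt7 (N n : ℕ) (hn : 1 ≤ n) :
    -Real.exp (-(π / 2 * Real.sqrt (2 * n / 3))) < R (2 * N) n ∧
      R (2 * N) n < c (2 * N) / (n : ℝ) ^ N +
        Real.exp (-(π / 2 * Real.sqrt (2 * n / 3))) := by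
  have hn0 : (0 : ℝ) < n := by exact_mod_cast hn
  obtain ⟨h0, hc⟩ := normalizedMainTerm_sub_sum_bounds hn N
  set C := π * Real.sqrt (2 * n / 3) with hC
  have hf : 0 < 4 * Real.sqrt 3 * n * Real.exp (-C) := by positivity
  have herr : |4 * Real.sqrt 3 * n * Real.exp (-C) * (p n - partitionMainTerm n)| <
      Real.exp (-(π / 2 * Real.sqrt (2 * n / 3))) := by
    rw [abs_mul, abs_of_pos hf]
    calc _ < 4 * Real.sqrt 3 * n * Real.exp (-C) *
          (Real.exp (partitionExponent n / 2) / (4 * Real.sqrt 3 * n)) := by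
          gcongr
          exact abs_p_sub_partitionMainTerm_lt hn
      _ = Real.exp (-C + partitionExponent n / 2) := by
          rw [Real.exp_add]
          field_simp
      _ ≤ _ := by
          have := partitionExponent_le n
          rw [← hC] at this
          refine Real.exp_le_exp.2 ?_
          linarith
  obtain ⟨h1, h2⟩ := abs_lt.1 herr
  have hR : R (2 * N) n = 4 * Real.sqrt 3 * n * Real.exp (-C) * (p n - partitionMainTerm n) +
      (normalizedMainTerm n - ∑ m ∈ range (2 * N), c m / (n : ℝ) ^ ((m : ℝ) / 2)) := by
    rw [R, normalizedMainTerm]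
    ring
  rw [hR]
  constructor <;> linarith
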